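/- arXiv:2206.01026 — 4 statements merged into one kernel-verified Lean document; each statement's English description precedes it below -/
import Mathlib

section
/- Let d ≥ 1 and p < d - 1, and let ξ_1, ξ_2 be independent random vectors uniform on the unit Euclidean sphere S^{d-1} in ℝ^d. Then E|ξ_1 + ξ_2|^{-p} = Γ(d/2) Γ(d-p-1) / ( Γ((d-p)/2) Γ(d - p/2 - 1) ). -/
open MeasureTheory Real Set
open scoped ENNReal

/-- `μ` is the uniform probability measure on the unit sphere `S^{d-1}` in `ℝ^d`:
it is supported on the unit sphere and invariant under every orthogonal map. -/
def IsUniformOnSphere {d : ℕ} (μ : Measure (EuclideanSpace ℝ (Fin d))) : Prop :=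
  μ (Metric.sphere (0 : EuclideanSpace ℝ (Fin d)) 1)ᶜ = 0 ∧
  ∀ Q : EuclideanSpace ℝ (Fin d) ≃ₗᵢ[ℝ] EuclideanSpace ℝ (Fin d), μ.map ⇑Q = μ

lemma lintegral_ofReal_of_integral_eq {α : Type*} [MeasurableSpace α] {ν : Measure α}
    {f : α → ℝ} {c : ℝ} (hf : 0 ≤ᵐ[ν] f) (h : ∫ x, f x ∂ν = c) (hc : c ≠ 0) :
    ∫⁻ x, ENNReal.ofReal (f x) ∂ν = ENNReal.ofReal c := by
  have hi : Integrable f ν := by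
    by_contra hn
    exact hc (h ▸ integral_undef hn)
  rw [← ofReal_integral_eq_lintegral_ofReal hi hf, h]

/-- The parabolic change of variables `u = √(t² + r²) + t`. -/
lemma lintegral_sqrt_add_rpow_mul_exp {r a : ℝ} (h : r ≠ 0 ∨ 0 < a) :
    ∫⁻ t : ℝ, ENNReal.ofReal ((√(t ^ 2 + r ^ 2) + t) ^ a *
        (exp (-√(t ^ 2 + r ^ 2)) / √(t ^ 2 + r ^ 2))) =
      ∫⁻ u in Ioi (0 : ℝ), ENNReal.ofReal (u ^ (a - 1) * exp (-(1 / 2 * u)) *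
        exp (-(1 / (2 * u)) * r ^ 2)) := by
  set g : ℝ → ℝ≥0∞ := fun t ↦ ENNReal.ofReal ((√(t ^ 2 + r ^ 2) + t) ^ a *
    (exp (-√(t ^ 2 + r ^ 2)) / √(t ^ 2 + r ^ 2))) with hg
  set f : ℝ → ℝ := fun u ↦ (u - r ^ 2 / u) / 2 with hf
  have hsqrt : ∀ u ∈ Ioi (0 : ℝ), √(f u ^ 2 + r ^ 2) = (u + r ^ 2 / u) / 2 := by
    intro u hu
    have hu : 0 < u := hu
    rw [show f u ^ 2 + r ^ 2 = ((u + r ^ 2 / u) / 2) ^ 2 by simp only [hf]; field_simp; ring]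
    exact sqrt_sq (by positivity)
  have hadd : ∀ u ∈ Ioi (0 : ℝ), √(f u ^ 2 + r ^ 2) + f u = u := by
    intro u hu
    rw [hsqrt u hu]
    simp only [hf]
    ring
  have hinj : InjOn f (Ioi 0) := by
    intro u hu v hv huv
    rw [← hadd u hu, ← hadd v hv, huv]
  have hder : ∀ u ∈ Ioi (0 : ℝ),
      HasDerivWithinAt f ((1 + r ^ 2 / u ^ 2) / 2) (Ioi 0) u := by
    intro u hu
    have hu : u ≠ 0 := ne_of_gt hu
    have := ((hasDerivAt_id u).sub ((hasDerivAt_inv hu).const_mul (r ^ 2))).div_const 2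
    refine (this.congr_deriv ?_).hasDerivWithinAt
    field_simp
    ring
  have himage : ∀ t : ℝ, t ∉ f '' Ioi 0 → g t = 0 := by
    intro t ht
    have hnn : 0 ≤ √(t ^ 2 + r ^ 2) + t := by
      have := abs_le_sqrt (show t ^ 2 ≤ t ^ 2 + r ^ 2 by nlinarith [sq_nonneg r])
      linarith [neg_abs_le t]
    have hzero : √(t ^ 2 + r ^ 2) + t = 0 := by
      by_contra hne
      have hpos := lt_of_le_of_ne hnn (Ne.symm hne)
      refine ht ⟨_, hpos, ?_⟩
      have hs := sq_sqrt (show 0 ≤ t ^ 2 + r ^ 2 by positivity)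
      simp only [hf]
      rw [div_eq_iff two_ne_zero, sub_eq_iff_eq_add, ← sub_eq_iff_eq_add', eq_div_iff hne]
      linear_combination hs
    have ha : 0 < a := by
      refine h.resolve_left fun hr ↦ ?_
      have hs := sq_sqrt (show 0 ≤ t ^ 2 + r ^ 2 by positivity)
      rw [eq_neg_of_add_eq_zero_left hzero] at hs
      have : 0 < r ^ 2 := by positivity
      linarith
    simp [hg, hzero, zero_rpow ha.ne']
  have hmeas : MeasurableSet (f '' Ioi 0) :=
    measurable_image_of_fderivWithin measurableSet_Ioi
      (fun u hu ↦ (hder u hu).hasFDerivWithinAt) hinj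
  have hrestrict : ∫⁻ t, g t = ∫⁻ t in f '' Ioi 0, g t := by
    rw [← lintegral_indicator hmeas]
    congr with t
    by_cases ht : t ∈ f '' Ioi 0
    · rw [indicator_of_mem ht]
    · rw [indicator_of_notMem ht, himage t ht]
  rw [hrestrict, lintegral_image_eq_lintegral_abs_deriv_mul measurableSet_Ioi hder hinj]
  refine setLIntegral_congr_fun measurableSet_Ioi fun u hu ↦ ?_
  have hu' : 0 < u := hu
  simp only [hg]
  rw [← ENNReal.ofReal_mul (abs_nonneg _), hadd u hu, hsqrt u hu,
    abs_of_nonneg (by positivity), mul_assoc (u ^ (a - 1)), ← exp_add, rpow_sub_one hu'.ne',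
    show -(1 / 2 * u) + -(1 / (2 * u)) * r ^ 2 = -((u + r ^ 2 / u) / 2) by field_simp; ring]
  congr 1
  field_simp

lemma lintegral_exp_neg_mul_sq_norm {V : Type*} [NormedAddCommGroup V] [InnerProductSpace ℝ V]
    [FiniteDimensional ℝ V] [MeasurableSpace V] [BorelSpace V] {b : ℝ} (hb : 0 < b) :
    ∫⁻ v : V, ENNReal.ofReal (exp (-b * ‖v‖ ^ 2)) =
      ENNReal.ofReal ((π / b) ^ (Module.finrank ℝ V / 2 : ℝ)) :=
  lintegral_ofReal_of_integral_eq (.of_forall fun _ ↦ (exp_pos _).le)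
    (GaussianFourier.integral_rexp_neg_mul_sq_norm hb) (by positivity)

lemma lintegral_prod_sqrt_add_rpow_mul_exp {n : ℕ} {a : ℝ} (ha : 0 < a + n / 2) :
    ∫⁻ x : ℝ × EuclideanSpace ℝ (Fin n), ENNReal.ofReal ((√(x.1 ^ 2 + ‖x.2‖ ^ 2) + x.1) ^ a *
        (exp (-√(x.1 ^ 2 + ‖x.2‖ ^ 2)) / √(x.1 ^ 2 + ‖x.2‖ ^ 2))) =
      ENNReal.ofReal ((2 * π) ^ (n / 2 : ℝ) * (2 ^ (a + n / 2) * Gamma (a + n / 2))) := by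
  have hae : ∀ᵐ w : EuclideanSpace ℝ (Fin n), ‖w‖ ≠ 0 ∨ 0 < a := by
    rcases Nat.eq_zero_or_pos n with rfl | hn
    · exact .of_forall fun _ ↦ .inr (by simpa using ha)
    · have : Nonempty (Fin n) := ⟨⟨0, hn⟩⟩
      filter_upwards [compl_mem_ae_iff.mpr (measure_singleton (0 : EuclideanSpace ℝ (Fin n)))]
        with w hw
      exact .inl (norm_ne_zero_iff.mpr hw)
  rw [Measure.volume_eq_prod, lintegral_prod_symm' _ (by fun_prop)]
  rw [lintegral_congr_ae (hae.mono fun w hw ↦ lintegral_sqrt_add_rpow_mul_exp hw),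
    lintegral_lintegral_swap (by fun_prop)]
  have hinner : ∀ u ∈ Ioi (0 : ℝ), ∫⁻ w : EuclideanSpace ℝ (Fin n),
      ENNReal.ofReal (u ^ (a - 1) * exp (-(1 / 2 * u)) * exp (-(1 / (2 * u)) * ‖w‖ ^ 2)) =
      ENNReal.ofReal ((2 * π) ^ (n / 2 : ℝ)) *
        ENNReal.ofReal (u ^ (a + n / 2 - 1) * exp (-(1 / 2 * u))) := by
    intro u hu
    have hu : 0 < u := hu
    simp_rw [ENNReal.ofReal_mul (show 0 ≤ u ^ (a - 1) * exp (-(1 / 2 * u)) by positivity)]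
    rw [lintegral_const_mul _ (by fun_prop), lintegral_exp_neg_mul_sq_norm (by positivity),
      ← ENNReal.ofReal_mul (by positivity), ← ENNReal.ofReal_mul (by positivity),
      finrank_euclideanSpace_fin, show π / (1 / (2 * u)) = 2 * π * u by field_simp,
      mul_rpow (by positivity) hu.le, show a + n / 2 - 1 = (a - 1) + n / 2 by ring,
      rpow_add hu]
    congr 1
    ring
  rw [setLIntegral_congr_fun measurableSet_Ioi hinner, lintegral_const_mul _ (by fun_prop),
    ENNReal.ofReal_mul (by positivity)]
  congr 1
  have hG := Gamma_pos_of_pos ha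
  refine lintegral_ofReal_of_integral_eq ?_ ?_ (by positivity)
  · filter_upwards [ae_restrict_mem measurableSet_Ioi] with u hu
    have hu : 0 < u := hu
    simp only [Pi.zero_apply]
    positivity
  · rw [integral_rpow_mul_exp_neg_mul_Ioi ha (by norm_num)]
    norm_num

section InnerProductSpace

variable {E : Type*} [NormedAddCommGroup E] [InnerProductSpace ℝ E]

lemma exists_linearIsometryEquiv_map_eq {x y : E} (h : ‖x‖ = ‖y‖) :
    ∃ Q : E ≃ₗᵢ[ℝ] E, Q x = y :=
  ⟨_, Submodule.reflection_sub h⟩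

open scoped RealInnerProductSpace in
lemma norm_add_inner_rpow_mul_exp (a : ℝ) {z y : E} (hz : z ≠ 0) (hy : ‖y‖ = 1) :
    (‖z‖ + ⟪z, y⟫) ^ a * (exp (-‖z‖) / ‖z‖) =
      2 ^ (-a) * (‖z‖ ^ (a - 1) * exp (-‖z‖)) * ‖‖z‖⁻¹ • z + y‖ ^ (2 * a) := by
  have hz' : 0 < ‖z‖ := norm_pos_iff.mpr hz
  have hsq : ‖z‖ + ⟪z, y⟫ = 2⁻¹ * ‖z‖ * ‖‖z‖⁻¹ • z + y‖ ^ 2 := by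
    rw [norm_add_sq_real, norm_smul, hy, real_inner_smul_left, norm_inv, norm_norm]
    field_simp
    ring
  rw [hsq, mul_rpow (by positivity) (by positivity), mul_rpow (by positivity) hz'.le,
    ← rpow_natCast ‖_ + y‖ 2, ← rpow_mul (norm_nonneg _), inv_rpow zero_le_two,
    rpow_neg zero_le_two, rpow_sub_one hz'.ne']
  push_cast
  ring

lemma exists_linearIsometryEquiv_prod [FiniteDimensional ℝ E] {n : ℕ}
    (hn : Module.finrank ℝ E = n + 1) {e : E} (he : ‖e‖ = 1) :
    ∃ L : WithLp 2 (ℝ × EuclideanSpace ℝ (Fin n)) ≃ₗᵢ[ℝ] E,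
      L (WithLp.toLp 2 (1, 0)) = e := by
  have hfin : Module.finrank ℝ (WithLp 2 (ℝ × EuclideanSpace ℝ (Fin n))) =
      Module.finrank ℝ E := by
    rw [(WithLp.linearEquiv 2 ℝ (ℝ × EuclideanSpace ℝ (Fin n))).finrank_eq]
    simp [hn, add_comm]
  let L := ((stdOrthonormalBasis ℝ (WithLp 2 (ℝ × EuclideanSpace ℝ (Fin n)))).reindex
    (finCongr hfin)).repr.trans (stdOrthonormalBasis ℝ E).repr.symm
  have h1 : ‖L (WithLp.toLp 2 (1, 0))‖ = ‖e‖ := by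
    rw [L.norm_map, he]
    simp
  obtain ⟨Q, hQ⟩ := exists_linearIsometryEquiv_map_eq h1
  exact ⟨L.trans Q, hQ⟩

variable [MeasurableSpace E] [BorelSpace E]

lemma lintegral_norm_add_rpow_eq {ν : Measure E} (hν : ∀ Q : E ≃ₗᵢ[ℝ] E, ν.map Q = ν) (q : ℝ)
    {x x' : E} (h : ‖x‖ = ‖x'‖) :
    ∫⁻ y, ENNReal.ofReal (‖x + y‖ ^ q) ∂ν = ∫⁻ y, ENNReal.ofReal (‖x' + y‖ ^ q) ∂ν := by
  obtain ⟨Q, rfl⟩ := exists_linearIsometryEquiv_map_eq h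
  nth_rw 2 [← hν Q]
  rw [lintegral_map (by fun_prop) Q.continuous.measurable]
  simp_rw [← map_add, Q.norm_map]

variable [FiniteDimensional ℝ E]

open scoped RealInnerProductSpace in
lemma lintegral_norm_add_inner_rpow_mul_exp {n : ℕ} (hn : Module.finrank ℝ E = n + 1) {a : ℝ}
    (ha : 0 < a + n / 2) {e : E} (he : ‖e‖ = 1) :
    ∫⁻ z : E, ENNReal.ofReal ((‖z‖ + ⟪z, e⟫) ^ a * (exp (-‖z‖) / ‖z‖)) =
      ENNReal.ofReal ((2 * π) ^ (n / 2 : ℝ) * (2 ^ (a + n / 2) * Gamma (a + n / 2))) := by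
  obtain ⟨L, hL⟩ := exists_linearIsometryEquiv_prod hn he
  rw [← lintegral_prod_sqrt_add_rpow_mul_exp ha,
    ← L.measurePreserving.lintegral_comp (by fun_prop),
    ← (WithLp.volume_preserving_toLp ℝ (EuclideanSpace ℝ (Fin n))).lintegral_comp (by fun_prop)]
  refine lintegral_congr fun x ↦ ?_
  have hnorm : ‖WithLp.toLp 2 x‖ = √(x.1 ^ 2 + ‖x.2‖ ^ 2) := by
    rw [← sqrt_sq (norm_nonneg (WithLp.toLp 2 x)), WithLp.prod_norm_sq_eq_of_L2]
    simp
  have hinner : ⟪L (WithLp.toLp 2 x), e⟫ = x.1 := by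
    rw [← hL, L.inner_map_map, WithLp.prod_inner_apply]
    simp
  rw [L.norm_map, hnorm, hinner]

lemma lintegral_norm_rpow_mul_exp_neg_norm {n : ℕ} (hn : Module.finrank ℝ E = n + 1) {a : ℝ}
    (ha : 0 < a + n) :
    ∫⁻ z : E, ENNReal.ofReal (‖z‖ ^ (a - 1) * exp (-‖z‖)) =
      ENNReal.ofReal (2 * √π ^ (n + 1) / Gamma ((n + 1) / 2) * Gamma (a + n)) := by
  have hG := Gamma_pos_of_pos ha
  have hG2 : 0 < Gamma (((n : ℝ) + 1) / 2) := Gamma_pos_of_pos (by positivity)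
  have : Nontrivial E := Module.nontrivial_of_finrank_pos (R := ℝ) (by omega)
  refine lintegral_ofReal_of_integral_eq (.of_forall fun _ ↦ by positivity) ?_ (by positivity)
  rw [integral_fun_norm_addHaar volume (fun r ↦ r ^ (a - 1) * exp (-r)), hn]
  have hball : volume.real (Metric.ball (0 : E) 1) =
      √π ^ (n + 1) / Gamma ((n + 1) / 2 + 1) := by
    rw [Measure.real, InnerProductSpace.volume_ball, hn]
    simp only [ENNReal.ofReal_one, one_pow, one_mul, Nat.cast_add, Nat.cast_one]
    exact ENNReal.toReal_ofReal (by
      have := Gamma_pos_of_pos (show (0 : ℝ) < (n + 1) / 2 + 1 by positivity)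
      positivity)
  have hint : ∫ r in Ioi (0 : ℝ), r ^ (n + 1 - 1) • (r ^ (a - 1) * exp (-r)) =
      Gamma (a + n) := by
    rw [Gamma_eq_integral ha]
    refine setIntegral_congr_fun measurableSet_Ioi fun r hr ↦ ?_
    have hr : 0 < r := hr
    simp only [add_tsub_cancel_right, smul_eq_mul]
    rw [show a + n - 1 = (a - 1) + n by ring, rpow_add hr, rpow_natCast]
    ring
  rw [hint, hball, Gamma_add_one (by positivity), nsmul_eq_mul, smul_eq_mul]
  push_cast
  field_simp

lemma lintegral_norm_add_rpow {n : ℕ} (hn : Module.finrank ℝ E = n + 1) {a : ℝ}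
    (ha : 0 < a + n / 2) {ν : Measure E} [IsProbabilityMeasure ν]
    (hν : ∀ Q : E ≃ₗᵢ[ℝ] E, ν.map Q = ν) (hsphere : ∀ᵐ y ∂ν, ‖y‖ = 1) {e : E} (he : ‖e‖ = 1) :
    ∫⁻ y, ENNReal.ofReal (‖e + y‖ ^ (2 * a)) ∂ν =
      ENNReal.ofReal ((2 * π) ^ (n / 2 : ℝ) * (2 ^ (a + n / 2) * Gamma (a + n / 2)) /
        (2 ^ (-a) * (2 * √π ^ (n + 1) / Gamma ((n + 1) / 2) * Gamma (a + n)))) := by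
  have : Nontrivial E := Module.nontrivial_of_finrank_pos (R := ℝ) (by omega)
  have han : 0 < a + n := by linarith [show (0 : ℝ) ≤ n by positivity]
  have hG := Gamma_pos_of_pos ha
  have hG1 := Gamma_pos_of_pos han
  have hG2 : 0 < Gamma (((n : ℝ) + 1) / 2) := Gamma_pos_of_pos (by positivity)
  set A := ∫⁻ y, ENNReal.ofReal (‖e + y‖ ^ (2 * a)) ∂ν with hA
  have hswap := lintegral_lintegral_swap (μ := ν) (ν := (volume : Measure E))
    (f := fun y z ↦ ENNReal.ofReal ((‖z‖ + inner ℝ z y) ^ a * (exp (-‖z‖) / ‖z‖)))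
    (by fun_prop)
  rw [lintegral_congr_ae (hsphere.mono fun y hy ↦ lintegral_norm_add_inner_rpow_mul_exp hn ha hy),
    lintegral_const, measure_univ, mul_one] at hswap
  have hinner : ∀ᵐ z : E, ∫⁻ y, ENNReal.ofReal ((‖z‖ + inner ℝ z y) ^ a *
      (exp (-‖z‖) / ‖z‖)) ∂ν =
      ENNReal.ofReal (2 ^ (-a)) * ENNReal.ofReal (‖z‖ ^ (a - 1) * exp (-‖z‖)) * A := by
    filter_upwards [compl_mem_ae_iff.mpr (measure_singleton (0 : E))] with z hz
    have hz : z ≠ 0 := hz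
    rw [hA, lintegral_norm_add_rpow_eq hν (2 * a) (x := e) (x' := ‖z‖⁻¹ • z)
      (by rw [he, norm_smul, norm_inv, norm_norm, inv_mul_cancel₀ (norm_ne_zero_iff.mpr hz)]),
      ← ENNReal.ofReal_mul (by positivity), ← lintegral_const_mul _ (by fun_prop)]
    refine lintegral_congr_ae (hsphere.mono fun y hy ↦ ?_)
    simp only
    rw [norm_add_inner_rpow_mul_exp a hz hy, ENNReal.ofReal_mul (by positivity)]
  rw [lintegral_congr_ae hinner, lintegral_mul_const _ (by fun_prop),
    lintegral_const_mul _ (by fun_prop), lintegral_norm_rpow_mul_exp_neg_norm hn han,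
    ← ENNReal.ofReal_mul (by positivity)] at hswap
  rw [ENNReal.ofReal_div_of_pos (by positivity), hswap, mul_comm, ENNReal.mul_div_cancel_right]
  · simp only [ne_eq, ENNReal.ofReal_eq_zero, not_le]
    positivity
  · exact ENNReal.ofReal_ne_top

end InnerProductSpace

lemma gamma_quotient_eq {n : ℕ} {a : ℝ} (ha : 0 < a + n / 2) :
    (2 * π) ^ (n / 2 : ℝ) * (2 ^ (a + n / 2) * Gamma (a + n / 2)) /
        (2 ^ (-a) * (2 * √π ^ (n + 1) / Gamma ((n + 1) / 2) * Gamma (a + n))) =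
      Gamma ((n + 1) / 2) * Gamma (n + 2 * a) / (Gamma (a + n / 2 + 1 / 2) * Gamma (a + n)) := by
  have hG := Gamma_pos_of_pos ha
  have hG1 : 0 < Gamma (a + n) :=
    Gamma_pos_of_pos (by linarith [show (0 : ℝ) ≤ n by positivity])
  have hG2 : 0 < Gamma (((n : ℝ) + 1) / 2) := Gamma_pos_of_pos (by positivity)
  have hG3 : 0 < Gamma (a + n / 2 + 1 / 2) := Gamma_pos_of_pos (by positivity)
  have hdup := Gamma_mul_Gamma_add_half (a + n / 2)
  rw [show 2 * (a + n / 2) = n + 2 * a by ring] at hdup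
  have hpi : √π ^ (n + 1) = π ^ (n / 2 : ℝ) * √π := by
    rw [pow_succ, ← rpow_natCast, sqrt_eq_rpow, ← rpow_mul pi_pos.le]
    congr 2
    ring
  have h2 : (2 : ℝ) ^ (n / 2 : ℝ) * 2 ^ (a + n / 2) * 2 ^ (1 - (n + 2 * a)) = 2 ^ (-a) * 2 := by
    rw [← rpow_add two_pos, ← rpow_add two_pos, ← rpow_add_one two_ne_zero]
    congr 1
    ring
  generalize a + n / 2 = s at *
  generalize Gamma (s + 1 / 2) = G at *
  rw [hpi, mul_rpow zero_le_two pi_pos.le, div_eq_div_iff (by positivity) (by positivity)]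
  field_simp
  linear_combination (2 : ℝ) ^ (n / 2 : ℝ) * 2 ^ s * hdup + Gamma (n + 2 * a) * √π * h2

/-- For `d ≥ 1`, `p < d - 1`, and `ξ₁, ξ₂` independent uniform on `S^{d-1}`,
`E|ξ₁ + ξ₂|^{-p} = Γ(d/2) Γ(d-p-1) / (Γ((d-p)/2) Γ(d - p/2 - 1))`. -/
theorem two_point_neg_moment
    (d : ℕ) (hd : 1 ≤ d) (p : ℝ) (hpd : p < (d : ℝ) - 1)
    (μ : Measure (EuclideanSpace ℝ (Fin d))) [IsProbabilityMeasure μ]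
    (hμ : IsUniformOnSphere μ) :
    ∫ x, ‖x.1 + x.2‖ ^ (-p) ∂(μ.prod μ)
      = Real.Gamma ((d : ℝ) / 2) * Real.Gamma ((d : ℝ) - p - 1) /
        (Real.Gamma (((d : ℝ) - p) / 2) * Real.Gamma ((d : ℝ) - p / 2 - 1)) := by
  obtain ⟨n, rfl⟩ : ∃ n, d = n + 1 := ⟨d - 1, by omega⟩
  push_cast at hpd ⊢
  have ha : 0 < -p / 2 + n / 2 := by linarith
  have hsphere : ∀ᵐ y ∂μ, ‖y‖ = 1 := by
    filter_upwards [compl_mem_ae_iff.mpr hμ.1] with y hy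
    simpa using hy
  rw [integral_eq_lintegral_of_nonneg_ae (.of_forall fun _ ↦ by positivity)
      (Measurable.aestronglyMeasurable (by fun_prop)), lintegral_prod _ (by fun_prop)]
  have hinner := fun (x : EuclideanSpace ℝ (Fin (n + 1))) (hx : ‖x‖ = 1) ↦
    lintegral_norm_add_rpow finrank_euclideanSpace_fin ha hμ.2 hsphere hx
  rw [show 2 * (-p / 2) = -p by ring] at hinner
  rw [lintegral_congr_ae (hsphere.mono hinner), lintegral_const, measure_univ, mul_one]
  have hG (s : ℝ) (hs : 0 < s) : 0 ≤ Gamma s := (Gamma_pos_of_pos hs).le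
  have hn : (0 : ℝ) ≤ n := n.cast_nonneg
  rw [gamma_quotient_eq ha, ENNReal.toReal_ofReal]
  · congr 3 <;> ring
  · exact div_nonneg (mul_nonneg (hG _ (by linarith)) (hG _ (by linarith)))
      (mul_nonneg (hG _ (by linarith)) (hG _ (by linarith)))
end

section
/- Let ξ be a random vector uniform on the unit Euclidean sphere S^3 in ℝ^4 and let 0 < p ≤ 2. Then for every 0 < t < 1, E|e_1 + √t ξ|^{-p} ≤ 1 - (p(2-p)/8) t - (p²(4-p²)/192) t². -/
open MeasureTheory Real Set
open scoped ENNReal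

/-- Differentiation under the integral sign when the measure is carried by a compact set on which
the parametric derivative is jointly continuous. -/
theorem hasDerivAt_integral_of_isCompact {E : Type*} [MetricSpace E] [MeasurableSpace E]
    [BorelSpace E] {μ : Measure E} [IsFiniteMeasure μ] {K : Set E} (hK : IsCompact K)
    (hμK : μ Kᶜ = 0) {U : Set ℝ} (hU : IsOpen U) {F F' : ℝ → E → ℝ}
    (hF : ∀ r ∈ U, ContinuousOn (F r) K)
    (hF' : ContinuousOn (fun q : ℝ × E => F' q.1 q.2) (U ×ˢ K))
    (hd : ∀ r ∈ U, ∀ x ∈ K, HasDerivAt (fun s => F s x) (F' r x) r) {r : ℝ} (hr : r ∈ U) :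
    HasDerivAt (fun s => ∫ x, F s x ∂μ) (∫ x, F' r x ∂μ) r := by
  have hae : ∀ᵐ x ∂μ, x ∈ K := by rwa [ae_iff]
  have hres : μ.restrict K = μ := Measure.restrict_eq_self_of_ae_mem hae
  obtain ⟨ε, hε, hball⟩ := Metric.nhds_basis_closedBall.mem_iff.1 (hU.mem_nhds hr)
  obtain ⟨C, hC⟩ := ((isCompact_closedBall r ε).prod hK).exists_bound_of_continuousOn
    (hF'.mono (Set.prod_mono hball subset_rfl))
  have hcont : ContinuousOn (F' r) K :=
    hF'.comp (f := fun x => (r, x)) (by fun_prop) fun x hx => ⟨hr, hx⟩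
  refine (hasDerivAt_integral_of_dominated_loc_of_deriv_le (bound := fun _ => C)
    (Metric.closedBall_mem_nhds r hε) ?_ ?_ ?_ ?_ (integrable_const C) ?_).2
  · filter_upwards [hU.mem_nhds hr] with s hs
    rw [← hres]
    exact (hF s hs).aestronglyMeasurable_of_subset_isCompact hK hK.measurableSet subset_rfl
  · rw [← hres]
    exact (hF r hr).integrableOn_compact hK
  · rw [← hres]
    exact hcont.aestronglyMeasurable_of_subset_isCompact hK hK.measurableSet subset_rfl
  · filter_upwards [hae] with x hx s hs
    exact hC (s, x) ⟨hs, hx⟩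
  · filter_upwards [hae] with x hx s hs
    exact hd s (hball hs) x hx

theorem le_of_hasDerivAt_nonneg {f f' : ℝ → ℝ} (hf : ∀ r ∈ Ico (0 : ℝ) 1, HasDerivAt f (f' r) r)
    (hf' : ∀ r ∈ Ioo (0 : ℝ) 1, 0 ≤ f' r) {r : ℝ} (hr : r ∈ Ico (0 : ℝ) 1) : f 0 ≤ f r := by
  refine monotoneOn_of_deriv_nonneg (convex_Ico 0 1)
    (fun x hx => (hf x hx).continuousAt.continuousWithinAt) ?_ ?_ ⟨le_rfl, one_pos⟩ hr hr.1
  · intro x hx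
    exact (hf x (interior_subset hx)).differentiableAt.differentiableWithinAt
  · intro x hx
    rw [(hf x (interior_subset hx)).deriv]
    rw [interior_Ico] at hx
    exact hf' x hx

/-- A radial function on the unit ball of `ℝ⁴` whose Laplacian is at least `α + β r²`
dominates the radial solution with that Laplacian and the same value at the origin. -/
theorem le_of_radial_laplacian_ge {g g' k : ℝ → ℝ} {α β : ℝ}
    (hg : ∀ r ∈ Ico (0 : ℝ) 1, HasDerivAt g (g' r) r)
    (hg' : ∀ r ∈ Ico (0 : ℝ) 1, HasDerivAt (fun s => s ^ 3 * g' s) (r ^ 3 * k r) r)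
    (hk : ∀ r ∈ Ico (0 : ℝ) 1, α + β * r ^ 2 ≤ k r) {r : ℝ} (hr : r ∈ Ico (0 : ℝ) 1) :
    g 0 + α * r ^ 2 / 8 + β * r ^ 4 / 24 ≤ g r := by
  have hflux : ∀ s ∈ Ioo (0 : ℝ) 1, α * s / 4 + β * s ^ 3 / 6 ≤ g' s := by
    intro s hs
    have h := le_of_hasDerivAt_nonneg
      (f := fun s => s ^ 3 * g' s - (α / 4 * s ^ 4 + β / 6 * s ^ 6))
      (f' := fun s => s ^ 3 * k s - (α / 4 * (4 * s ^ 3) + β / 6 * (6 * s ^ 5)))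
      (fun s hs => (hg' s hs).sub (by
        simpa using ((hasDerivAt_pow 4 s).const_mul (α / 4)).fun_add
          ((hasDerivAt_pow 6 s).const_mul (β / 6))))
      (fun s hs => by
        have := mul_le_mul_of_nonneg_left (hk s ⟨hs.1.le, hs.2⟩) (pow_nonneg hs.1.le 3)
        linarith) ⟨hs.1.le, hs.2⟩
    have hs3 : 0 < s ^ 3 := pow_pos hs.1 3
    refine le_of_mul_le_mul_left ?_ hs3
    norm_num at h
    linarith
  have h := le_of_hasDerivAt_nonneg
    (f := fun s => g s - (α / 8 * s ^ 2 + β / 24 * s ^ 4))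
    (f' := fun s => g' s - (α / 8 * (2 * s) + β / 24 * (4 * s ^ 3)))
    (fun s hs => (hg s hs).sub (by
      simpa using ((hasDerivAt_pow 2 s).const_mul (α / 8)).fun_add
        ((hasDerivAt_pow 4 s).const_mul (β / 24))))
    (fun s hs => by linarith [hflux s hs]) hr
  norm_num at h
  linarith

theorem EuclideanSpace.sum_sq_eq_one_of_mem_sphere {x : EuclideanSpace ℝ (Fin 4)}
    (hx : x ∈ Metric.sphere (0 : EuclideanSpace ℝ (Fin 4)) 1) :
    x 0 ^ 2 + x 1 ^ 2 + x 2 ^ 2 + x 3 ^ 2 = 1 := by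
  have h : ‖x‖ = 1 := by simpa using hx
  have h2 := EuclideanSpace.real_norm_sq_eq x
  rw [h, Fin.sum_univ_four] at h2
  linarith

/-- The rotation by the angle `s` in the plane of the coordinates `0` and `j`. -/
noncomputable def planeRotation (j : Fin 4) (hj : j ≠ 0) (s : ℝ) :
    EuclideanSpace ℝ (Fin 4) ≃ₗᵢ[ℝ] EuclideanSpace ℝ (Fin 4) :=
  LinearIsometry.toLinearIsometryEquiv
    { toFun := fun x => WithLp.toLp 2 fun i =>
        if i = 0 then cos s * x 0 - sin s * x j
        else if i = j then sin s * x 0 + cos s * x j else x i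
      map_add' := fun x y => by
        ext i
        simp only [PiLp.add_apply]
        split_ifs <;> ring
      map_smul' := fun a x => by
        ext i
        simp only [PiLp.smul_apply, smul_eq_mul, RingHom.id_apply]
        split_ifs <;> ring
      norm_map' := fun x => by
        rw [← sq_eq_sq₀ (norm_nonneg _) (norm_nonneg _), EuclideanSpace.real_norm_sq_eq,
          EuclideanSpace.real_norm_sq_eq, Fin.sum_univ_four, Fin.sum_univ_four]
        have hs := sin_sq_add_cos_sq s
        fin_cases j
        · exact absurd rfl hj
        · simp
          linear_combination (x 0 ^ 2 + x 1 ^ 2) * hs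
        · simp
          linear_combination (x 0 ^ 2 + x 2 ^ 2) * hs
        · simp
          linear_combination (x 0 ^ 2 + x 3 ^ 2) * hs }
    rfl

theorem planeRotation_apply_zero (j : Fin 4) (hj : j ≠ 0) (s : ℝ)
    (x : EuclideanSpace ℝ (Fin 4)) :
    planeRotation j hj s x 0 = cos s * x 0 - sin s * x j := by
  simp [planeRotation]

theorem planeRotation_apply_self (j : Fin 4) (hj : j ≠ 0) (s : ℝ)
    (x : EuclideanSpace ℝ (Fin 4)) :
    planeRotation j hj s x j = sin s * x 0 + cos s * x j := by
  simp [planeRotation, hj]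

theorem IsUniformOnSphere.ae_mem_sphere {d : ℕ} {μ : Measure (EuclideanSpace ℝ (Fin d))}
    (hμ : IsUniformOnSphere μ) :
    ∀ᵐ x ∂μ, x ∈ Metric.sphere (0 : EuclideanSpace ℝ (Fin d)) 1 := by
  rw [ae_iff]
  exact hμ.1

theorem IsUniformOnSphere.integrable {μ : Measure (EuclideanSpace ℝ (Fin 4))}
    [IsProbabilityMeasure μ] (hμ : IsUniformOnSphere μ) {f : EuclideanSpace ℝ (Fin 4) → ℝ}
    (hf : ContinuousOn f (Metric.sphere 0 1)) : Integrable f μ := by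
  rw [← Measure.restrict_eq_self_of_ae_mem hμ.ae_mem_sphere]
  exact hf.integrableOn_compact (isCompact_sphere 0 1)

theorem EuclideanSpace.apply_zero_mem_Icc_of_mem_sphere {x : EuclideanSpace ℝ (Fin 4)}
    (hx : x ∈ Metric.sphere (0 : EuclideanSpace ℝ (Fin 4)) 1) : x 0 ∈ Icc (-1 : ℝ) 1 := by
  rw [mem_Icc, ← abs_le, ← sq_le_one_iff_abs_le_one]
  nlinarith [EuclideanSpace.sum_sq_eq_one_of_mem_sphere hx, sq_nonneg (x 1), sq_nonneg (x 2),
    sq_nonneg (x 3)]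

theorem IsUniformOnSphere.integral_sq_mul_deriv {μ : Measure (EuclideanSpace ℝ (Fin 4))}
    [IsProbabilityMeasure μ] (hμ : IsUniformOnSphere μ) {j : Fin 4} (hj : j ≠ 0) {P P' : ℝ → ℝ}
    (hP : ∀ y ∈ Icc (-1 : ℝ) 1, HasDerivAt P (P' y) y) (hP' : ContinuousOn P' (Icc (-1) 1)) :
    ∫ x, x j ^ 2 * P' (x 0) ∂μ = ∫ x, x 0 * P (x 0) ∂μ := by
  have hPc : ContinuousOn P (Icc (-1) 1) := fun y hy => (hP y hy).continuousAt.continuousWithinAt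
  have hmem : ∀ s : ℝ, ∀ x ∈ Metric.sphere (0 : EuclideanSpace ℝ (Fin 4)) 1,
      cos s * x 0 - sin s * x j ∈ Icc (-1 : ℝ) 1 := by
    intro s x hx
    have h1 := EuclideanSpace.sum_sq_eq_one_of_mem_sphere hx
    have h2 : x 0 ^ 2 + x j ^ 2 ≤ 1 := by
      fin_cases j
      · exact absurd rfl hj
      all_goals
        simp
        nlinarith [sq_nonneg (x 1), sq_nonneg (x 2), sq_nonneg (x 3)]
    rw [mem_Icc, ← abs_le, ← sq_le_one_iff_abs_le_one]
    nlinarith [sin_sq_add_cos_sq s, sq_nonneg (sin s * x 0 + cos s * x j)]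
  have hcont : ContinuousOn (fun q : ℝ × EuclideanSpace ℝ (Fin 4) =>
      cos q.1 * q.2 0 - sin q.1 * q.2 j)
      (univ ×ˢ Metric.sphere (0 : EuclideanSpace ℝ (Fin 4)) 1) := by fun_prop
  have hmaps : MapsTo (fun q : ℝ × EuclideanSpace ℝ (Fin 4) =>
      cos q.1 * q.2 0 - sin q.1 * q.2 j)
      (univ ×ˢ Metric.sphere (0 : EuclideanSpace ℝ (Fin 4)) 1) (Icc (-1) 1) :=
    fun q hq => hmem q.1 q.2 hq.2
  have hPcomp := hPc.comp hcont hmaps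
  have hP'comp := hP'.comp hcont hmaps
  have key := hasDerivAt_integral_of_isCompact (μ := μ) (isCompact_sphere 0 1) hμ.1 isOpen_univ
    (F := fun s x => P (cos s * x 0 - sin s * x j) * (sin s * x 0 + cos s * x j))
    (F' := fun s x => P' (cos s * x 0 - sin s * x j) * (-sin s * x 0 - cos s * x j) *
      (sin s * x 0 + cos s * x j) +
      P (cos s * x 0 - sin s * x j) * (cos s * x 0 + -sin s * x j))
    (fun s _ => (hPc.comp (by fun_prop) (hmem s)).mul (by fun_prop))
    ((((hP'comp.mul (by fun_prop)).mul (by fun_prop))).add (hPcomp.mul (by fun_prop)))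
    (fun s _ x hx => ((hP _ (hmem s x hx)).comp s
      (((hasDerivAt_cos s).mul_const (x 0)).sub ((hasDerivAt_sin s).mul_const (x j)))).mul
      (((hasDerivAt_sin s).mul_const (x 0)).add ((hasDerivAt_cos s).mul_const (x j))))
    (mem_univ 0)
  have hconst : ∀ s : ℝ,
      ∫ x, P (cos s * x 0 - sin s * x j) * (sin s * x 0 + cos s * x j) ∂μ =
        ∫ x, P (x 0) * x j ∂μ := by
    intro s
    have hemb := (planeRotation j hj s).toHomeomorph.measurableEmbedding
    have h := hemb.integral_map (μ := μ) fun x => P (x 0) * x j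
    have hm : μ.map ⇑(planeRotation j hj s).toHomeomorph = μ := hμ.2 (planeRotation j hj s)
    rw [hm] at h
    rw [h]
    refine integral_congr_ae (ae_of_all _ fun x => ?_)
    simp [planeRotation_apply_zero, planeRotation_apply_self]
  simp only [hconst] at key
  have h0 := key.unique (hasDerivAt_const _ _)
  have hm0 : MapsTo (fun x : EuclideanSpace ℝ (Fin 4) => x 0) (Metric.sphere 0 1)
      (Icc (-1) 1) := fun x hx => EuclideanSpace.apply_zero_mem_Icc_of_mem_sphere hx
  have hi1 : Integrable (fun x : EuclideanSpace ℝ (Fin 4) => x j ^ 2 * P' (x 0)) μ :=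
    hμ.integrable (ContinuousOn.mul (by fun_prop) (hP'.comp (by fun_prop) hm0))
  have hi2 : Integrable (fun x : EuclideanSpace ℝ (Fin 4) => x 0 * P (x 0)) μ :=
    hμ.integrable (ContinuousOn.mul (by fun_prop) (hPc.comp (by fun_prop) hm0))
  have h1 : ∫ x, (x 0 * P (x 0) - x j ^ 2 * P' (x 0)) ∂μ = 0 := by
    rw [← h0]
    refine integral_congr_ae (ae_of_all _ fun x => ?_)
    simp
    ring
  rw [integral_sub hi2 hi1] at h1
  linarith

/-- Integration by parts against the first marginal of the uniform measure on `S³`. -/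
theorem IsUniformOnSphere.integral_one_sub_sq_mul_deriv
    {μ : Measure (EuclideanSpace ℝ (Fin 4))} [IsProbabilityMeasure μ] (hμ : IsUniformOnSphere μ)
    {P P' : ℝ → ℝ} (hP : ∀ y ∈ Icc (-1 : ℝ) 1, HasDerivAt P (P' y) y)
    (hP' : ContinuousOn P' (Icc (-1) 1)) :
    ∫ x, (1 - x 0 ^ 2) * P' (x 0) ∂μ = 3 * ∫ x, x 0 * P (x 0) ∂μ := by
  have hi : ∀ j : Fin 4,
      Integrable (fun x : EuclideanSpace ℝ (Fin 4) => x j ^ 2 * P' (x 0)) μ := fun j =>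
    hμ.integrable (ContinuousOn.mul (by fun_prop) (hP'.comp (by fun_prop)
      fun x hx => EuclideanSpace.apply_zero_mem_Icc_of_mem_sphere hx))
  have h : ∫ x, (1 - x 0 ^ 2) * P' (x 0) ∂μ =
      ∫ x, (x 1 ^ 2 * P' (x 0) + x 2 ^ 2 * P' (x 0)) + x 3 ^ 2 * P' (x 0) ∂μ := by
    refine integral_congr_ae ?_
    filter_upwards [hμ.ae_mem_sphere] with x hx
    linear_combination -P' (x 0) * EuclideanSpace.sum_sq_eq_one_of_mem_sphere hx
  rw [h, integral_add ((hi 1).fun_add (hi 2)) (hi 3), integral_add (hi 1) (hi 2),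
    hμ.integral_sq_mul_deriv (by decide) hP hP', hμ.integral_sq_mul_deriv (by decide) hP hP',
    hμ.integral_sq_mul_deriv (by decide) hP hP']
  ring

theorem one_add_sq_add_two_mul_pos {r y : ℝ} (hr : r ∈ Ioo (-1 : ℝ) 1)
    (hy : y ∈ Icc (-1 : ℝ) 1) : 0 < 1 + r ^ 2 + 2 * r * y := by
  obtain ⟨h1, h2⟩ := hr
  obtain ⟨h3, h4⟩ := hy
  rcases le_total 0 r with h | h
  · nlinarith [mul_nonneg h (by linarith : 0 ≤ 1 + y), mul_pos (sub_pos.2 h2) (sub_pos.2 h2)]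
  · nlinarith [mul_nonneg (neg_nonneg.2 h) (by linarith : 0 ≤ 1 - y),
      mul_pos (by linarith : 0 < 1 + r) (by linarith : 0 < 1 + r)]

/-- The mean of `|e₁ + r ξ|^{2c}` over the distribution `μ` of a unit vector `ξ`. -/
noncomputable def shiftedMean (μ : Measure (EuclideanSpace ℝ (Fin 4))) (c r : ℝ) : ℝ :=
  ∫ x, (1 + r ^ 2 + 2 * r * x 0) ^ c ∂μ

/-- The radial derivative of `shiftedMean`. -/
noncomputable def shiftedMeanDeriv (μ : Measure (EuclideanSpace ℝ (Fin 4))) (c r : ℝ) : ℝ :=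
  ∫ x, 2 * c * (r + x 0) * (1 + r ^ 2 + 2 * r * x 0) ^ (c - 1) ∂μ

theorem continuousOn_shift_rpow (c : ℝ) :
    ContinuousOn (fun q : ℝ × EuclideanSpace ℝ (Fin 4) => (1 + q.1 ^ 2 + 2 * q.1 * q.2 0) ^ c)
      (Ioo (-1) 1 ×ˢ Metric.sphere 0 1) :=
  ContinuousOn.rpow_const (by fun_prop) fun _ hq => Or.inl (one_add_sq_add_two_mul_pos hq.1
    (EuclideanSpace.apply_zero_mem_Icc_of_mem_sphere hq.2)).ne'

theorem continuousOn_shift_rpow_right (c : ℝ) {r : ℝ} (hr : r ∈ Ioo (-1 : ℝ) 1) :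
    ContinuousOn (fun x : EuclideanSpace ℝ (Fin 4) => (1 + r ^ 2 + 2 * r * x 0) ^ c)
      (Metric.sphere 0 1) :=
  ContinuousOn.rpow_const (by fun_prop) fun _ hq => Or.inl (one_add_sq_add_two_mul_pos hr
    (EuclideanSpace.apply_zero_mem_Icc_of_mem_sphere hq)).ne'

theorem hasDerivAt_shift_rpow (c : ℝ) {r : ℝ} (hr : r ∈ Ioo (-1 : ℝ) 1) {y : ℝ}
    (hy : y ∈ Icc (-1 : ℝ) 1) :
    HasDerivAt (fun s => (1 + s ^ 2 + 2 * s * y) ^ c)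
      (2 * c * (r + y) * (1 + r ^ 2 + 2 * r * y) ^ (c - 1)) r := by
  have h1 : HasDerivAt (fun s => 1 + s ^ 2 + 2 * s * y) (2 * r + 2 * y) r := by
    simpa using ((hasDerivAt_pow 2 r).const_add 1).fun_add
      (((hasDerivAt_id r).const_mul 2).mul_const y)
  convert h1.rpow_const (p := c) (Or.inl (one_add_sq_add_two_mul_pos hr hy).ne') using 1
  ring

theorem IsUniformOnSphere.shiftedMean_nonneg {μ : Measure (EuclideanSpace ℝ (Fin 4))}
    (hμ : IsUniformOnSphere μ) (c : ℝ) {r : ℝ} (hr : r ∈ Ico (0 : ℝ) 1) : 0 ≤ shiftedMean μ c r := by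
  refine integral_nonneg_of_ae ?_
  filter_upwards [hμ.ae_mem_sphere] with x hx
  exact rpow_nonneg (one_add_sq_add_two_mul_pos ⟨by linarith [hr.1], hr.2⟩
    (EuclideanSpace.apply_zero_mem_Icc_of_mem_sphere hx)).le c

section Uniform

variable {μ : Measure (EuclideanSpace ℝ (Fin 4))} [IsProbabilityMeasure μ]

theorem IsUniformOnSphere.hasDerivAt_shiftedMean (hμ : IsUniformOnSphere μ) (c : ℝ) {r : ℝ}
    (hr : r ∈ Ioo (-1 : ℝ) 1) :
    HasDerivAt (shiftedMean μ c) (shiftedMeanDeriv μ c r) r :=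
  hasDerivAt_integral_of_isCompact (isCompact_sphere 0 1) hμ.1 isOpen_Ioo
    (F' := fun r x => 2 * c * (r + x 0) * (1 + r ^ 2 + 2 * r * x 0) ^ (c - 1))
    (fun _ hs => continuousOn_shift_rpow_right c hs)
    (ContinuousOn.mul (by fun_prop) (continuousOn_shift_rpow (c - 1)))
    (fun _ hs _ hx => hasDerivAt_shift_rpow c hs
      (EuclideanSpace.apply_zero_mem_Icc_of_mem_sphere hx)) hr

/-- The spherical mean satisfies the radial form of
`Δ |v|^{2c} = 4 c (c + 1) |v|^{2c - 2}` in `ℝ⁴`. -/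
theorem IsUniformOnSphere.hasDerivAt_cube_mul_shiftedMeanDeriv (hμ : IsUniformOnSphere μ) (c : ℝ)
    {r : ℝ} (hr : r ∈ Ioo (-1 : ℝ) 1) :
    HasDerivAt (fun s => s ^ 3 * shiftedMeanDeriv μ c s)
      (r ^ 3 * (4 * c * (c + 1) * shiftedMean μ (c - 1) r)) r := by
  have hd : HasDerivAt (shiftedMeanDeriv μ c)
      (∫ x, 2 * c * (1 + r ^ 2 + 2 * r * x 0) ^ (c - 1) + 2 * c * (r + x 0) *
        (2 * (c - 1) * (r + x 0) * (1 + r ^ 2 + 2 * r * x 0) ^ (c - 1 - 1)) ∂μ) r :=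
    hasDerivAt_integral_of_isCompact (isCompact_sphere 0 1) hμ.1 isOpen_Ioo
      (F := fun r x => 2 * c * (r + x 0) * (1 + r ^ 2 + 2 * r * x 0) ^ (c - 1))
      (F' := fun r x => 2 * c * (1 + r ^ 2 + 2 * r * x 0) ^ (c - 1) + 2 * c * (r + x 0) *
        (2 * (c - 1) * (r + x 0) * (1 + r ^ 2 + 2 * r * x 0) ^ (c - 1 - 1)))
      (fun _ hs => ContinuousOn.mul (by fun_prop) (continuousOn_shift_rpow_right (c - 1) hs))
      ((ContinuousOn.mul (by fun_prop) (continuousOn_shift_rpow (c - 1))).add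
        (ContinuousOn.mul (by fun_prop)
          (ContinuousOn.mul (by fun_prop) (continuousOn_shift_rpow (c - 1 - 1)))))
      (fun s hs x hx => by
        have h1 : HasDerivAt (fun s => 2 * c * (s + x 0)) (2 * c) s := by
          simpa using ((hasDerivAt_id s).add_const (x 0)).const_mul (2 * c)
        exact h1.mul (hasDerivAt_shift_rpow (c - 1) hs
          (EuclideanSpace.apply_zero_mem_Icc_of_mem_sphere hx))) hr
  have hpos : ∀ y ∈ Icc (-1 : ℝ) 1, 0 < 1 + r ^ 2 + 2 * r * y := fun y hy =>
    one_add_sq_add_two_mul_pos hr hy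
  have hparts := hμ.integral_one_sub_sq_mul_deriv
    (P := fun y => (1 + r ^ 2 + 2 * r * y) ^ (c - 1))
    (P' := fun y => 2 * r * (c - 1) * (1 + r ^ 2 + 2 * r * y) ^ (c - 1 - 1))
    (fun y hy => by
      have h1 : HasDerivAt (fun y => 1 + r ^ 2 + 2 * r * y) (2 * r) y := by
        simpa using ((hasDerivAt_id y).const_mul (2 * r)).const_add (1 + r ^ 2)
      exact h1.rpow_const (Or.inl (hpos y hy).ne'))
    (ContinuousOn.mul (by fun_prop)
      (ContinuousOn.rpow_const (by fun_prop) fun y hy => Or.inl (hpos y hy).ne'))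
  have hW := continuousOn_shift_rpow_right (c - 1) hr
  have hV := continuousOn_shift_rpow_right (c - 1 - 1) hr
  have hi1 := hμ.integrable
    (ContinuousOn.fun_mul (f := fun x => 2 * c * (r + x 0)) (by fun_prop) hW)
  have hi2 := hμ.integrable ((ContinuousOn.fun_mul (f := fun _ => 2 * c) (by fun_prop) hW).fun_add
    (ContinuousOn.fun_mul (f := fun x => 2 * c * (r + x 0)) (by fun_prop)
      (ContinuousOn.fun_mul (f := fun x => 2 * (c - 1) * (r + x 0)) (by fun_prop) hV)))
  have hi3 := hμ.integrable hW
  have hi4 := hμ.integrable (ContinuousOn.fun_mul (f := fun x => x 0) (by fun_prop) hW)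
  have hi5 := hμ.integrable (ContinuousOn.fun_mul (f := fun x => 1 - x 0 ^ 2) (by fun_prop)
    (ContinuousOn.fun_mul (f := fun _ => 2 * r * (c - 1)) (by fun_prop) hV))
  have hprod := (hasDerivAt_pow 3 r).fun_mul hd
  refine hprod.congr_deriv ?_
  have hcomb : ∫ x, (2 * c * (r + x 0) * (1 + r ^ 2 + 2 * r * x 0) ^ (c - 1)) * (3 * r ^ 2) +
      (2 * c * (1 + r ^ 2 + 2 * r * x 0) ^ (c - 1) + 2 * c * (r + x 0) *
        (2 * (c - 1) * (r + x 0) * (1 + r ^ 2 + 2 * r * x 0) ^ (c - 1 - 1))) * r ^ 3 ∂μ =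
      ∫ x, (1 + r ^ 2 + 2 * r * x 0) ^ (c - 1) * (4 * c * (c + 1) * r ^ 3) +
        (x 0 * (1 + r ^ 2 + 2 * r * x 0) ^ (c - 1)) * (6 * c * r ^ 2) -
        ((1 - x 0 ^ 2) * (2 * r * (c - 1) * (1 + r ^ 2 + 2 * r * x 0) ^ (c - 1 - 1))) *
          (2 * c * r ^ 2) ∂μ := by
    refine integral_congr_ae ?_
    filter_upwards [hμ.ae_mem_sphere] with x hx
    have hp := hpos _ (EuclideanSpace.apply_zero_mem_Icc_of_mem_sphere hx)
    have hs : (1 + r ^ 2 + 2 * r * x 0) ^ (c - 1) =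
        (1 + r ^ 2 + 2 * r * x 0) ^ (c - 1 - 1) * (1 + r ^ 2 + 2 * r * x 0) := by
      rw [← rpow_add_one hp.ne']
      ring_nf
    rw [hs]
    ring
  rw [integral_add (hi1.mul_const _) (hi2.mul_const _),
    integral_sub ((hi3.mul_const _).fun_add (hi4.mul_const _)) (hi5.mul_const _),
    integral_add (hi3.mul_const _) (hi4.mul_const _)] at hcomb
  simp only [integral_mul_const] at hcomb
  simp only [shiftedMean, shiftedMeanDeriv]
  rw [hparts] at hcomb
  norm_num
  linear_combination hcomb

theorem shiftedMean_zero (c : ℝ) : shiftedMean μ c 0 = 1 := by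
  simp [shiftedMean]

theorem IsUniformOnSphere.le_shiftedMean (hμ : IsUniformOnSphere μ) {c α β : ℝ}
    (hk : ∀ r ∈ Ico (0 : ℝ) 1,
      α + β * r ^ 2 ≤ 4 * c * (c + 1) * shiftedMean μ (c - 1) r) {r : ℝ}
    (hr : r ∈ Ico (0 : ℝ) 1) :
    1 + α * r ^ 2 / 8 + β * r ^ 4 / 24 ≤ shiftedMean μ c r := by
  have hI : ∀ s ∈ Ico (0 : ℝ) 1, s ∈ Ioo (-1 : ℝ) 1 := fun s hs => ⟨by linarith [hs.1], hs.2⟩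
  simpa only [shiftedMean_zero] using le_of_radial_laplacian_ge
    (fun s hs => hμ.hasDerivAt_shiftedMean c (hI s hs))
    (fun s hs => hμ.hasDerivAt_cube_mul_shiftedMeanDeriv c (hI s hs)) hk hr

theorem IsUniformOnSphere.shiftedMean_le (hμ : IsUniformOnSphere μ) {c α β : ℝ}
    (hk : ∀ r ∈ Ico (0 : ℝ) 1,
      4 * c * (c + 1) * shiftedMean μ (c - 1) r ≤ -(α + β * r ^ 2)) {r : ℝ}
    (hr : r ∈ Ico (0 : ℝ) 1) :
    shiftedMean μ c r ≤ 1 - α * r ^ 2 / 8 - β * r ^ 4 / 24 := by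
  have hI : ∀ s ∈ Ico (0 : ℝ) 1, s ∈ Ioo (-1 : ℝ) 1 := fun s hs => ⟨by linarith [hs.1], hs.2⟩
  have h := le_of_radial_laplacian_ge (g := fun s => -shiftedMean μ c s)
    (g' := fun s => -shiftedMeanDeriv μ c s)
    (k := fun s => -(4 * c * (c + 1) * shiftedMean μ (c - 1) s)) (α := α) (β := β)
    (fun s hs => (hμ.hasDerivAt_shiftedMean c (hI s hs)).neg)
    (fun s hs => by
      simpa only [mul_neg] using (hμ.hasDerivAt_cube_mul_shiftedMeanDeriv c (hI s hs)).fun_neg)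
    (fun s hs => by linarith [hk s hs]) hr
  simp only [shiftedMean_zero] at h
  linarith

theorem IsUniformOnSphere.one_le_shiftedMean (hμ : IsUniformOnSphere μ) {c : ℝ} (hc : c ≤ -1)
    {r : ℝ} (hr : r ∈ Ico (0 : ℝ) 1) : 1 ≤ shiftedMean μ c r := by
  have h := hμ.le_shiftedMean (c := c) (α := 0) (β := 0) (fun s hs => by
    have := mul_nonneg (by nlinarith : 0 ≤ 4 * c * (c + 1))
      (hμ.shiftedMean_nonneg (c - 1) hs)
    linarith) hr
  linarith

theorem IsUniformOnSphere.one_add_le_shiftedMean (hμ : IsUniformOnSphere μ) {c : ℝ}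
    (hc : c ≤ -1) {r : ℝ} (hr : r ∈ Ico (0 : ℝ) 1) :
    1 + c * (c + 1) / 2 * r ^ 2 ≤ shiftedMean μ c r := by
  have h := hμ.le_shiftedMean (c := c) (α := 4 * c * (c + 1)) (β := 0) (fun s hs => by
    have := mul_le_mul_of_nonneg_left
      (hμ.one_le_shiftedMean (by linarith : c - 1 ≤ -1) hs)
      (by nlinarith : 0 ≤ 4 * c * (c + 1))
    linarith) hr
  linarith

theorem IsUniformOnSphere.shiftedMean_le_two_terms (hμ : IsUniformOnSphere μ) {p : ℝ}
    (hp0 : 0 ≤ p) (hp2 : p ≤ 2) {r : ℝ} (hr : r ∈ Ico (0 : ℝ) 1) :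
    shiftedMean μ (-p / 2) r ≤
      1 - (p * (2 - p) / 8) * r ^ 2 - (p ^ 2 * (4 - p ^ 2) / 192) * r ^ 4 := by
  have h := hμ.shiftedMean_le (c := -p / 2) (α := p * (2 - p))
    (β := p * (2 - p) * (p * (p + 2) / 8)) (fun s hs => by
      have := mul_le_mul_of_nonneg_left
        (hμ.one_add_le_shiftedMean (by linarith : -p / 2 - 1 ≤ -1) hs)
        (mul_nonneg hp0 (sub_nonneg.2 hp2))
      linarith) hr
  linarith

end Uniform

theorem norm_single_add_smul_sq {x : EuclideanSpace ℝ (Fin 4)}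
    (hx : x ∈ Metric.sphere (0 : EuclideanSpace ℝ (Fin 4)) 1) (r : ℝ) :
    ‖EuclideanSpace.single (0 : Fin 4) (1 : ℝ) + r • x‖ ^ 2 = 1 + r ^ 2 + 2 * r * x 0 := by
  rw [EuclideanSpace.real_norm_sq_eq, Fin.sum_univ_four]
  simp
  linear_combination r ^ 2 * EuclideanSpace.sum_sq_eq_one_of_mem_sphere hx

theorem IsUniformOnSphere.lintegral_eq_shiftedMean {μ : Measure (EuclideanSpace ℝ (Fin 4))}
    [IsProbabilityMeasure μ] (hμ : IsUniformOnSphere μ) (p : ℝ) {r : ℝ}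
    (hr : r ∈ Ioo (-1 : ℝ) 1) :
    ∫⁻ x, (‖EuclideanSpace.single (0 : Fin 4) (1 : ℝ) + r • x‖₊ : ℝ≥0∞) ^ (-p) ∂μ =
      ENNReal.ofReal (shiftedMean μ (-p / 2) r) := by
  rw [shiftedMean, ofReal_integral_eq_lintegral_ofReal
    (hμ.integrable (continuousOn_shift_rpow_right _ hr))]
  · refine lintegral_congr_ae ?_
    filter_upwards [hμ.ae_mem_sphere] with x hx
    have hpos := one_add_sq_add_two_mul_pos hr
      (EuclideanSpace.apply_zero_mem_Icc_of_mem_sphere hx)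
    rw [← norm_single_add_smul_sq hx r] at hpos ⊢
    have hn : 0 < ‖EuclideanSpace.single (0 : Fin 4) (1 : ℝ) + r • x‖ :=
      (norm_nonneg _).lt_of_ne' fun h => by simp [h] at hpos
    rw [← rpow_natCast, ← rpow_mul hn.le, ← enorm_eq_nnnorm, ← ofReal_norm,
      ENNReal.ofReal_rpow_of_pos hn]
    congr 2
    push_cast
    ring
  · filter_upwards [hμ.ae_mem_sphere] with x hx
    exact rpow_nonneg (one_add_sq_add_two_mul_pos hr
      (EuclideanSpace.apply_zero_mem_Icc_of_mem_sphere hx)).le _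

/-- For `ξ` uniform on the unit sphere `S³` in `ℝ⁴`, `0 < p ≤ 2` and `0 < t < 1`,
`E|e₁ + √t ξ|^{-p} ≤ 1 - (p(2-p)/8) t - (p²(4-p²)/192) t²`. -/
theorem two_coeff_upper_bound_dim_four
    (p : ℝ) (hp0 : 0 < p) (hp2 : p ≤ 2)
    (μ : Measure (EuclideanSpace ℝ (Fin 4))) [IsProbabilityMeasure μ]
    (hμ : IsUniformOnSphere μ)
    (t : ℝ) (ht0 : 0 < t) (ht1 : t < 1) :
    ∫⁻ x, (‖EuclideanSpace.single (0 : Fin 4) (1 : ℝ) + Real.sqrt t • x‖₊ : ℝ≥0∞) ^ (-p) ∂μ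
      ≤ ENNReal.ofReal
          (1 - (p * (2 - p) / 8) * t - (p ^ 2 * (4 - p ^ 2) / 192) * t ^ 2) := by
  have hr : Real.sqrt t ∈ Ico (0 : ℝ) 1 :=
    ⟨Real.sqrt_nonneg t, by rw [Real.sqrt_lt' one_pos]; linarith⟩
  have hsq : Real.sqrt t ^ 2 = t := Real.sq_sqrt ht0.le
  rw [hμ.lintegral_eq_shiftedMean p ⟨by linarith [hr.1], hr.2⟩]
  refine ENNReal.ofReal_le_ofReal ((hμ.shiftedMean_le_two_terms hp0.le hp2 hr).trans_eq ?_)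
  rw [show Real.sqrt t ^ 4 = (Real.sqrt t ^ 2) ^ 2 by ring, hsq]
end

section
/- Let d ≥ 3, let ξ be a random vector uniform on the unit Euclidean sphere S^{d-1} in ℝ^d, and let 0 < p ≤ d - 2. Then for every nonzero vector v in ℝ^d and every a > 0, E|v + aξ|^{-p} ≤ min{ |v|^{-p}, a^{-p} }. -/
open MeasureTheory Real Set
open scoped ENNReal

open Filter Topology
open scoped RealInnerProductSpace

theorem hasDerivAt_integral_of_continuousOn_of_isCompact
    {E : Type*} [MetricSpace E] [MeasurableSpace E] [BorelSpace E]
    {μ : Measure E} [IsFiniteMeasure μ] {K : Set E} (hK : IsCompact K) (hμ : μ Kᶜ = 0)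
    {U : Set ℝ} (hU : IsOpen U) {f f' : ℝ → E → ℝ}
    (hf : ∀ s ∈ U, ContinuousOn (f s) K)
    (hf' : ContinuousOn (fun q : ℝ × E => f' q.1 q.2) (U ×ˢ K))
    (hd : ∀ s ∈ U, ∀ x ∈ K, HasDerivAt (fun r => f r x) (f' s x) s) {s : ℝ} (hs : s ∈ U) :
    HasDerivAt (fun r => ∫ x, f r x ∂μ) (∫ x, f' s x ∂μ) s := by
  have hKae : ∀ᵐ x ∂μ, x ∈ K := hμ
  have hres : μ.restrict K = μ := Measure.restrict_eq_self_of_ae_mem hKae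
  obtain ⟨ε, hε, hεU⟩ := Metric.nhds_basis_closedBall.mem_iff.1 (hU.mem_nhds hs)
  obtain ⟨C, hC⟩ := ((isCompact_closedBall s ε).prod hK).exists_bound_of_continuousOn
    (hf'.mono (prod_mono hεU subset_rfl))
  have hmeas : ∀ g : E → ℝ, ContinuousOn g K → AEStronglyMeasurable g μ := fun g hg => by
    rw [← hres]; exact hg.aestronglyMeasurable_of_isCompact hK hK.measurableSet
  refine (hasDerivAt_integral_of_dominated_loc_of_deriv_le (bound := fun _ => C)
    (Metric.closedBall_mem_nhds s hε) ?_ ?_ ?_ ?_ (integrable_const C) ?_).2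
  · filter_upwards [hU.mem_nhds hs] with r hr using hmeas _ (hf r hr)
  · have := (hf s hs).integrableOn_compact (μ := μ) hK
    rwa [IntegrableOn, hres] at this
  · refine hmeas _ (hf'.comp (f := fun x => (s, x)) (by fun_prop) fun x hx => ⟨hs, hx⟩)
  · filter_upwards [hKae] with x hx r hr using hC (r, x) ⟨hr, hx⟩
  · filter_upwards [hKae] with x hx r hr using hd r (hεU hr) x hx

namespace IsUniformOnSphere

variable {d : ℕ} {μ : Measure (EuclideanSpace ℝ (Fin d))}

theorem integrable_of_continuousOn [IsFiniteMeasure μ] (hμ : IsUniformOnSphere μ)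
    {f : EuclideanSpace ℝ (Fin d) → ℝ} (hf : ContinuousOn f (Metric.sphere 0 1)) :
    Integrable f μ := by
  have hres : μ.restrict (Metric.sphere 0 1) = μ := Measure.restrict_eq_self_of_ae_mem hμ.1
  have := hf.integrableOn_compact (μ := μ) (isCompact_sphere _ _)
  rwa [IntegrableOn, hres] at this

theorem ae_norm_eq_one (hμ : IsUniformOnSphere μ) : ∀ᵐ x ∂μ, ‖x‖ = 1 := by
  have : ∀ᵐ x ∂μ, x ∈ Metric.sphere (0 : EuclideanSpace ℝ (Fin d)) 1 := hμ.1
  simpa using this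

/-- Integration by parts along the rotation field in the plane spanned by `u` and `w`. -/
theorem integral_inner_mul_eq_integral_deriv_mul_sq [IsFiniteMeasure μ] (hμ : IsUniformOnSphere μ)
    {u w : EuclideanSpace ℝ (Fin d)} (hu : ‖u‖ = 1) (hw : ‖w‖ = 1) (huw : ⟪u, w⟫ = 0)
    {g g' : ℝ → ℝ} (hg : ∀ t ∈ Icc (-1 : ℝ) 1, HasDerivAt g (g' t) t)
    (hg' : ContinuousOn g' (Icc (-1) 1)) :
    ∫ x, ⟪u, x⟫ * g ⟪u, x⟫ ∂μ = ∫ x, g' ⟪u, x⟫ * ⟪w, x⟫ ^ 2 ∂μ := by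
  have hgc : ContinuousOn g (Icc (-1) 1) := fun t ht => (hg t ht).continuousAt.continuousWithinAt
  let T : ℝ → EuclideanSpace ℝ (Fin d) → ℝ :=
    fun α x => ⟪u, x⟫ * cos (2 * α) + ⟪w, x⟫ * sin (2 * α)
  let W : ℝ → EuclideanSpace ℝ (Fin d) → ℝ :=
    fun α x => ⟪u, x⟫ * sin (2 * α) - ⟪w, x⟫ * cos (2 * α)
  have hwu : ⟪w, u⟫ = 0 := by rw [real_inner_comm, huw]
  have huu : ⟪u, u⟫ = 1 := by simp [hu]
  have hww : ⟪w, w⟫ = 1 := by simp [hw]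
  have hrot : ∀ α : ℝ, ∃ Q : EuclideanSpace ℝ (Fin d) ≃ₗᵢ[ℝ] EuclideanSpace ℝ (Fin d),
      ∀ x, ⟪u, Q x⟫ = T α x ∧ ⟪w, Q x⟫ = W α x := by
    intro α
    have hn : ‖cos α • u + sin α • w‖ = 1 := by
      have : ‖cos α • u + sin α • w‖ ^ 2 = 1 := by
        rw [← real_inner_self_eq_norm_sq]
        simp only [inner_add_left, inner_add_right, real_inner_smul_left, real_inner_smul_right,
          huu, hww, huw, hwu]
        nlinarith [sin_sq_add_cos_sq α]
      exact (pow_eq_one_iff_of_nonneg (norm_nonneg _) two_ne_zero).1 this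
    refine ⟨(ℝ ∙ (cos α • u + sin α • w)).reflection, fun x => ?_⟩
    rw [Submodule.reflection_singleton_apply]
    simp only [hn, inner_sub_right, inner_add_left, inner_add_right, real_inner_smul_left,
      real_inner_smul_right, huu, hww, huw, hwu, T, W, sin_two_mul, cos_two_mul, two_smul,
      RCLike.ofReal_real_eq_id, id]
    have := sin_sq_add_cos_sq α
    constructor
    · ring
    · linear_combination 2 * ⟪w, x⟫ * this
  have hTmem : ∀ α, ∀ x ∈ Metric.sphere (0 : EuclideanSpace ℝ (Fin d)) 1,
      T α x ∈ Icc (-1 : ℝ) 1 := by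
    intro α x hx
    obtain ⟨Q, hQ⟩ := hrot α
    rw [← (hQ x).1]
    exact real_inner_mem_Icc_of_norm_eq_one hu (by simpa using hx)
  have hconst : ∀ α, ∫ x, g (T α x) * W α x ∂μ = ∫ x, g ⟪u, x⟫ * ⟪w, x⟫ ∂μ := by
    intro α
    obtain ⟨Q, hQ⟩ := hrot α
    have h := MeasureTheory.integral_map_equiv (μ := μ) Q.toHomeomorph.toMeasurableEquiv
      (fun x => g ⟪u, x⟫ * ⟪w, x⟫)
    have hm : μ.map Q.toHomeomorph.toMeasurableEquiv = μ := hμ.2 Q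
    rw [hm] at h
    rw [h]
    refine integral_congr_ae (Eventually.of_forall fun x => ?_)
    change _ = g ⟪u, Q x⟫ * ⟪w, Q x⟫
    rw [(hQ x).1, (hQ x).2]
  have hT : Continuous fun q : ℝ × EuclideanSpace ℝ (Fin d) => T q.1 q.2 := by
    fun_prop
  have hW : Continuous fun q : ℝ × EuclideanSpace ℝ (Fin d) => W q.1 q.2 := by
    fun_prop
  have hder := hasDerivAt_integral_of_continuousOn_of_isCompact (μ := μ)
    (isCompact_sphere (0 : EuclideanSpace ℝ (Fin d)) 1) hμ.1 isOpen_univ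
    (f := fun α x => g (T α x) * W α x)
    (f' := fun α x => g' (T α x) * (-2 * W α x) * W α x + g (T α x) * (2 * T α x))
    (fun α _ => (hgc.comp (hT.comp (by fun_prop : Continuous fun x => (α, x))).continuousOn
      (hTmem α)).mul (hW.comp (by fun_prop : Continuous fun x => (α, x))).continuousOn)
    (by
      have h1 := hg'.comp (s := (univ : Set ℝ) ×ˢ Metric.sphere _ 1) hT.continuousOn
        fun q hq => hTmem q.1 q.2 hq.2
      have h2 := hgc.comp (s := (univ : Set ℝ) ×ˢ Metric.sphere _ 1) hT.continuousOn
        fun q hq => hTmem q.1 q.2 hq.2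
      exact ((h1.mul (continuous_const.mul hW).continuousOn).mul hW.continuousOn).add
        (h2.mul (continuous_const.mul hT).continuousOn))
    (by
      intro α _ x hx
      have h2 : HasDerivAt (fun r : ℝ => 2 * r) 2 α := by
        simpa using (hasDerivAt_id α).const_mul (2 : ℝ)
      have hc := h2.cos
      have hs := h2.sin
      have hTd : HasDerivAt (fun r => T r x) (-2 * W α x) α := by
        refine ((hc.const_mul ⟪u, x⟫).add (hs.const_mul ⟪w, x⟫)).congr_deriv ?_
        simp only [W]
        ring
      have hWd : HasDerivAt (fun r => W r x) (2 * T α x) α := by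
        refine ((hs.const_mul ⟪u, x⟫).sub (hc.const_mul ⟪w, x⟫)).congr_deriv ?_
        simp only [T]
        ring
      exact ((hg _ (hTmem α x hx)).comp α hTd).mul hWd)
    (mem_univ 0)
  simp only [hconst] at hder
  have h0 := hder.unique (hasDerivAt_const _ _)
  have hTu : ∀ x ∈ Metric.sphere (0 : EuclideanSpace ℝ (Fin d)) 1, ⟪u, x⟫ ∈ Icc (-1 : ℝ) 1 := by
    intro x hx
    simpa [T] using hTmem 0 x hx
  have i1 : Integrable (fun x => ⟪u, x⟫ * g ⟪u, x⟫) μ := hμ.integrable_of_continuousOn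
    ((by fun_prop : ContinuousOn (fun x => ⟪u, x⟫) _).mul (hgc.comp (by fun_prop) hTu))
  have i2 : Integrable (fun x => g' ⟪u, x⟫ * ⟪w, x⟫ ^ 2) μ := hμ.integrable_of_continuousOn
    ((hg'.comp (by fun_prop) hTu).mul (by fun_prop : ContinuousOn (fun x => ⟪w, x⟫ ^ 2) _))
  have h1 : ∫ x, (g' (T 0 x) * (-2 * W 0 x) * W 0 x + g (T 0 x) * (2 * T 0 x)) ∂μ
      = 2 * (∫ x, ⟪u, x⟫ * g ⟪u, x⟫ ∂μ) - 2 * ∫ x, g' ⟪u, x⟫ * ⟪w, x⟫ ^ 2 ∂μ := by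
    rw [← integral_const_mul, ← integral_const_mul,
      ← integral_sub (i1.const_mul 2) (i2.const_mul 2)]
    refine integral_congr_ae (Eventually.of_forall fun x => ?_)
    simp only [T, W, mul_zero, cos_zero, sin_zero]
    ring_nf
  linarith

/-- The spherical Laplacian has mean zero: integration by parts for zonal functions. -/
theorem integral_inner_mul_eq_integral_deriv [IsFiniteMeasure μ] (hμ : IsUniformOnSphere μ)
    {u : EuclideanSpace ℝ (Fin d)} (hu : ‖u‖ = 1)
    {g g' : ℝ → ℝ} (hg : ∀ t ∈ Icc (-1 : ℝ) 1, HasDerivAt g (g' t) t)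
    (hg' : ContinuousOn g' (Icc (-1) 1)) :
    ((d : ℝ) - 1) * ∫ x, ⟪u, x⟫ * g ⟪u, x⟫ ∂μ = ∫ x, g' ⟪u, x⟫ * (1 - ⟪u, x⟫ ^ 2) ∂μ := by
  have hd : 0 < d := by
    rcases Nat.eq_zero_or_pos d with rfl | h
    · simp [Subsingleton.elim u 0] at hu
    · exact h
  have : NeZero d := ⟨hd.ne'⟩
  obtain ⟨b, hb⟩ := Orthonormal.exists_orthonormalBasis_extension_of_card_eq (𝕜 := ℝ)
    (E := EuclideanSpace ℝ (Fin d)) (ι := Fin d) (by simp) (v := fun _ => u) (s := {0})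
    (by
      refine ⟨fun i => hu, fun i j hij => (hij (Subsingleton.elim i j)).elim⟩)
  have hb0 : b 0 = u := hb 0 rfl
  have hTu : ∀ x ∈ Metric.sphere (0 : EuclideanSpace ℝ (Fin d)) 1, ⟪u, x⟫ ∈ Icc (-1 : ℝ) 1 := by
    exact fun x hx => real_inner_mem_Icc_of_norm_eq_one hu (by simpa using hx)
  have hint : ∀ i, Integrable (fun x => g' ⟪u, x⟫ * ⟪b i, x⟫ ^ 2) μ := fun i =>
    hμ.integrable_of_continuousOn
      ((hg'.comp (by fun_prop) hTu).mul (by fun_prop : ContinuousOn (fun x => ⟪b i, x⟫ ^ 2) _))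
  have hsum : ∑ i ∈ Finset.univ.erase (0 : Fin d), ∫ x, ⟪u, x⟫ * g ⟪u, x⟫ ∂μ
      = ∑ i ∈ Finset.univ.erase (0 : Fin d), ∫ x, g' ⟪u, x⟫ * ⟪b i, x⟫ ^ 2 ∂μ :=
    Finset.sum_congr rfl fun i hi =>
      hμ.integral_inner_mul_eq_integral_deriv_mul_sq hu (b.norm_eq_one i)
        (by rw [← hb0]; exact b.inner_eq_zero (Finset.ne_of_mem_erase hi).symm) hg hg'
  rw [← integral_finsetSum _ fun i _ => hint i, Finset.sum_const,
    Finset.card_erase_of_mem (Finset.mem_univ _), Finset.card_univ, Fintype.card_fin,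
    nsmul_eq_mul, Nat.cast_sub hd, Nat.cast_one] at hsum
  rw [hsum]
  refine integral_congr_ae ?_
  filter_upwards [hμ.ae_norm_eq_one] with x hx
  have h1 := b.sum_sq_inner_right x
  rw [hx, ← Finset.add_sum_erase _ _ (Finset.mem_univ (0 : Fin d)), hb0] at h1
  rw [← Finset.mul_sum]
  congr 1
  linarith

/-- The mean of `‖x‖ ^ (-p)` over a sphere whose closed ball omits the origin is at most
its value at the centre, since `‖x‖ ^ (-p)` is superharmonic off the origin. -/
theorem integral_rpow_le [IsProbabilityMeasure μ] (hμ : IsUniformOnSphere μ) (hd : 3 ≤ d)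
    {p : ℝ} (hp0 : 0 < p) (hpd : p ≤ (d : ℝ) - 2)
    {u : EuclideanSpace ℝ (Fin d)} (hu : ‖u‖ = 1) {r s : ℝ} (hs : 0 ≤ s) (hsr : s < r) :
    ∫ x, (r ^ 2 + s ^ 2 + 2 * r * s * ⟪u, x⟫) ^ (-p / 2) ∂μ ≤ r ^ (-p) := by
  have hr : 0 < r := hs.trans_lt hsr
  let D : ℝ → ℝ → ℝ := fun s t => r ^ 2 + s ^ 2 + 2 * r * s * t
  have hD : ∀ s ∈ Ioo (-r) r, ∀ t ∈ Icc (-1 : ℝ) 1, 0 < D s t := by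
    intro s hs t ht
    have h1 : 0 < (r - s) ^ 2 := by have := hs.2; apply pow_pos; linarith
    have h2 : 0 < (r + s) ^ 2 := by have := hs.1; apply pow_pos; linarith
    simp only [D]
    rcases le_total 0 t with h | h
    · nlinarith [mul_nonneg (sub_nonneg.2 ht.2) h1.le, mul_pos (by linarith : 0 < 1 + t) h2]
    · nlinarith [mul_nonneg (by linarith [ht.1] : 0 ≤ 1 + t) h2.le,
        mul_pos (by linarith : 0 < 1 - t) h1]
  have hu_mem : ∀ x ∈ Metric.sphere (0 : EuclideanSpace ℝ (Fin d)) 1, ⟪u, x⟫ ∈ Icc (-1 : ℝ) 1 :=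
    fun x hx => real_inner_mem_Icc_of_norm_eq_one hu (by simpa using hx)
  have hDs : ∀ q : ℝ, ∀ s ∈ Ioo (-r) r, ∀ t ∈ Icc (-1 : ℝ) 1,
      HasDerivAt (fun s => D s t ^ q) (2 * q * (s + r * t) * D s t ^ (q - 1)) s := by
    intro q s hs t ht
    have h : HasDerivAt (fun s => D s t) (2 * s + 2 * r * t) s := by
      refine (((hasDerivAt_pow 2 s).const_add (r ^ 2)).add
        (((hasDerivAt_id s).const_mul (2 * r)).mul_const t)).congr_deriv ?_
      norm_num
    exact (h.rpow_const (p := q) (Or.inl (hD s hs t ht).ne')).congr_deriv (by ring)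
  have hDt : ∀ q : ℝ, ∀ s ∈ Ioo (-r) r, ∀ t ∈ Icc (-1 : ℝ) 1,
      HasDerivAt (fun t => D s t ^ q) (2 * q * r * s * D s t ^ (q - 1)) t := by
    intro q s hs t ht
    have h : HasDerivAt (fun t => D s t) (2 * r * s) t := by
      exact (((hasDerivAt_id t).const_mul (2 * r * s)).const_add (r ^ 2 + s ^ 2)).congr_deriv
        (mul_one _)
    exact (h.rpow_const (p := q) (Or.inl (hD s hs t ht).ne')).congr_deriv (by ring)
  have hcont : ∀ q : ℝ, ContinuousOn
      (fun y : ℝ × EuclideanSpace ℝ (Fin d) => D y.1 ⟪u, y.2⟫ ^ q)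
      (Ioo (-r) r ×ˢ Metric.sphere 0 1) := fun q =>
    ContinuousOn.rpow_const (by fun_prop) fun y hy =>
      Or.inl (hD _ hy.1 _ (hu_mem _ hy.2)).ne'
  have hslice : ∀ {f : ℝ → EuclideanSpace ℝ (Fin d) → ℝ},
      ContinuousOn (fun y : ℝ × EuclideanSpace ℝ (Fin d) => f y.1 y.2)
        (Ioo (-r) r ×ˢ Metric.sphere 0 1) →
      ∀ s ∈ Ioo (-r) r, ContinuousOn (f s) (Metric.sphere 0 1) := fun hf s hs =>
    hf.comp (f := fun x => (s, x)) (by fun_prop) fun x hx => ⟨hs, hx⟩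
  let q : ℝ := -p / 2
  let G : ℝ → ℝ := fun s => ∫ x, D s ⟪u, x⟫ ^ q ∂μ
  let f1 : ℝ → EuclideanSpace ℝ (Fin d) → ℝ := fun s x =>
    2 * q * (s + r * ⟪u, x⟫) * D s ⟪u, x⟫ ^ (q - 1)
  let f2 : ℝ → EuclideanSpace ℝ (Fin d) → ℝ := fun s x =>
    2 * q * D s ⟪u, x⟫ ^ (q - 1)
      + 2 * q * (s + r * ⟪u, x⟫) * (2 * (q - 1) * (s + r * ⟪u, x⟫) * D s ⟪u, x⟫ ^ (q - 1 - 1))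
  have hf1 : ContinuousOn (fun y : ℝ × EuclideanSpace ℝ (Fin d) => f1 y.1 y.2)
      (Ioo (-r) r ×ˢ Metric.sphere 0 1) :=
    ContinuousOn.mul (by fun_prop) (hcont _)
  have hf2 : ContinuousOn (fun y : ℝ × EuclideanSpace ℝ (Fin d) => f2 y.1 y.2)
      (Ioo (-r) r ×ˢ Metric.sphere 0 1) :=
    (continuousOn_const.mul (hcont _)).add
      (ContinuousOn.mul (by fun_prop) (ContinuousOn.mul (by fun_prop) (hcont _)))
  have hG1 : ∀ s ∈ Ioo (-r) r, HasDerivAt G (∫ x, f1 s x ∂μ) s := fun s hs =>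
    hasDerivAt_integral_of_continuousOn_of_isCompact (isCompact_sphere _ _) hμ.1 isOpen_Ioo
      (hslice (hcont q)) hf1 (fun s hs x hx => hDs q s hs _ (hu_mem x hx)) hs
  have hG2 : ∀ s ∈ Ioo (-r) r,
      HasDerivAt (fun s => ∫ x, f1 s x ∂μ) (∫ x, f2 s x ∂μ) s := fun s hs =>
    hasDerivAt_integral_of_continuousOn_of_isCompact (isCompact_sphere _ _) hμ.1 isOpen_Ioo
      (hslice hf1) hf2 (fun s hs x hx => by
        have h : HasDerivAt (fun s => 2 * q * (s + r * ⟪u, x⟫)) (2 * q) s := by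
          simpa using ((hasDerivAt_id s).add_const (r * ⟪u, x⟫)).const_mul (2 * q)
        exact h.mul (hDs (q - 1) s hs _ (hu_mem x hx))) hs
  have hlap : ∀ s ∈ Ioo (-r) r,
      s ^ 2 * (∫ x, f2 s x ∂μ) + ((d : ℝ) - 1) * s * (∫ x, f1 s x ∂μ) ≤ 0 := by
    intro s hs
    have hibp := hμ.integral_inner_mul_eq_integral_deriv hu (hDt (q - 1) s hs)
      (continuousOn_const.mul (ContinuousOn.rpow_const (by fun_prop) fun t ht =>
        Or.inl (hD s hs t ht).ne'))
    have hc := hslice (f := fun s x => D s ⟪u, x⟫ ^ (q - 1)) (hcont (q - 1)) s hs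
    have hc' := hslice (f := fun s x => D s ⟪u, x⟫ ^ (q - 1 - 1)) (hcont (q - 1 - 1)) s hs
    have i1 := (hμ.integrable_of_continuousOn (hslice hf1 s hs)).const_mul (((d : ℝ) - 1) * s)
    have i2 := (hμ.integrable_of_continuousOn (hslice hf2 s hs)).const_mul (s ^ 2)
    have i3 : Integrable (fun x => ⟪u, x⟫ * D s ⟪u, x⟫ ^ (q - 1)) μ :=
      hμ.integrable_of_continuousOn (ContinuousOn.mul (by fun_prop) hc)
    have i4 : Integrable (fun x => 2 * (q - 1) * r * s * D s ⟪u, x⟫ ^ (q - 1 - 1)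
        * (1 - ⟪u, x⟫ ^ 2)) μ :=
      hμ.integrable_of_continuousOn
        ((continuousOn_const.mul hc').mul (by fun_prop))
    have key : s ^ 2 * (∫ x, f2 s x ∂μ) + ((d : ℝ) - 1) * s * (∫ x, f1 s x ∂μ)
        = ∫ x, -p * ((d : ℝ) - 2 - p) * s ^ 2 * D s ⟪u, x⟫ ^ (q - 1) ∂μ := by
      have e : s ^ 2 * (∫ x, f2 s x ∂μ) + ((d : ℝ) - 1) * s * (∫ x, f1 s x ∂μ)
          = s ^ 2 * (∫ x, f2 s x ∂μ) + ((d : ℝ) - 1) * s * (∫ x, f1 s x ∂μ)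
            - (2 * q * r * s * ((d : ℝ) - 1)) * (∫ x, ⟪u, x⟫ * D s ⟪u, x⟫ ^ (q - 1) ∂μ)
            + (2 * q * r * s) * ∫ x, 2 * (q - 1) * r * s * D s ⟪u, x⟫ ^ (q - 1 - 1)
              * (1 - ⟪u, x⟫ ^ 2) ∂μ := by
        linear_combination (2 * q * r * s) * hibp
      have i21 : Integrable (fun x => s ^ 2 * f2 s x + ((d : ℝ) - 1) * s * f1 s x) μ := i2.add i1
      have i213 : Integrable (fun x => s ^ 2 * f2 s x + ((d : ℝ) - 1) * s * f1 s x
          - 2 * q * r * s * ((d : ℝ) - 1) * (⟪u, x⟫ * D s ⟪u, x⟫ ^ (q - 1))) μ :=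
        i21.sub (i3.const_mul _)
      rw [e, ← integral_const_mul, ← integral_const_mul, ← integral_const_mul,
        ← integral_const_mul, ← integral_add i2 i1, ← integral_sub i21 (i3.const_mul _),
        ← integral_add i213 (i4.const_mul _)]
      refine integral_congr_ae ?_
      filter_upwards [hμ.ae_norm_eq_one] with x hx
      have hpos := hD s hs _ (real_inner_mem_Icc_of_norm_eq_one hu hx)
      have hpow : D s ⟪u, x⟫ ^ (q - 1) = D s ⟪u, x⟫ ^ (q - 1 - 1) * D s ⟪u, x⟫ := by
        rw [← rpow_add_one hpos.ne', sub_add_cancel]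
      simp only [f1, f2, hpow, q]
      generalize D s ⟪u, x⟫ ^ (-p / 2 - 1 - 1) = A
      simp only [D]
      ring
    rw [key]
    refine integral_nonpos_of_ae ?_
    filter_upwards [hμ.ae_norm_eq_one] with x hx
    have hpos := rpow_pos_of_pos (hD s hs _ (real_inner_mem_Icc_of_norm_eq_one hu hx)) (q - 1)
    have : 0 ≤ p * ((d : ℝ) - 2 - p) * s ^ 2 * D s ⟪u, x⟫ ^ (q - 1) :=
      mul_nonneg (mul_nonneg (mul_nonneg hp0.le (by linarith)) (sq_nonneg s)) hpos.le
    simp only [Pi.zero_apply]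
    linarith
  have hsub : Ico 0 r ⊆ Ioo (-r) r := fun s hs => ⟨by linarith [hs.1], hs.2⟩
  obtain ⟨m, rfl⟩ : ∃ m, d = m + 3 := ⟨d - 3, by omega⟩
  let K : ℝ → ℝ := fun s => s ^ (m + 2) * ∫ x, f1 s x ∂μ
  have hK : ∀ s ∈ Ioo (-r) r, HasDerivAt K
      (s ^ m * (s ^ 2 * (∫ x, f2 s x ∂μ) + (((m + 3 : ℕ) : ℝ) - 1) * s * ∫ x, f1 s x ∂μ)) s := by
    intro s hs
    refine ((hasDerivAt_pow (m + 2) s).mul (hG2 s hs)).congr_deriv ?_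
    push_cast
    ring
  have hKanti : AntitoneOn K (Ico 0 r) := by
    refine antitoneOn_of_deriv_nonpos (convex_Ico 0 r)
      (fun s hs => (hK s (hsub hs)).continuousAt.continuousWithinAt)
      (fun s hs => (hK s (hsub (interior_subset hs))).differentiableAt.differentiableWithinAt)
      fun s hs => ?_
    have hs' := interior_subset hs
    rw [(hK s (hsub hs')).deriv]
    exact mul_nonpos_of_nonneg_of_nonpos (pow_nonneg hs'.1 m) (hlap s (hsub hs'))
  have hGanti : AntitoneOn G (Ico 0 r) := by
    refine antitoneOn_of_deriv_nonpos (convex_Ico 0 r)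
      (fun s hs => (hG1 s (hsub hs)).continuousAt.continuousWithinAt)
      (fun s hs => (hG1 s (hsub (interior_subset hs))).differentiableAt.differentiableWithinAt)
      fun s hs => ?_
    have hs' := interior_subset hs
    rw [interior_Ico] at hs
    rw [(hG1 s (hsub hs')).deriv]
    have h := hKanti ⟨le_rfl, hr⟩ hs' hs'.1
    simp only [K, ne_eq, Nat.add_eq_zero_iff, OfNat.ofNat_ne_zero, and_false, not_false_eq_true,
      zero_pow, zero_mul] at h
    exact nonpos_of_mul_nonpos_right h (pow_pos hs.1 _)
  have h := hGanti ⟨le_rfl, hr⟩ ⟨hs, hsr⟩ hs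
  have h0 : G 0 = r ^ (-p) := by
    simp only [G, D, q]
    simp only [ne_eq, OfNat.ofNat_ne_zero, not_false_eq_true, zero_pow, add_zero, mul_zero,
      zero_mul, integral_const, probReal_univ, one_smul]
    rw [← rpow_natCast, ← rpow_mul hr.le]
    congr 1
    push_cast
    ring
  exact h.trans_eq h0

theorem lintegral_ofReal_rpow_le [IsProbabilityMeasure μ] (hμ : IsUniformOnSphere μ) (hd : 3 ≤ d)
    {p : ℝ} (hp0 : 0 < p) (hpd : p ≤ (d : ℝ) - 2)
    {u : EuclideanSpace ℝ (Fin d)} (hu : ‖u‖ = 1) {r s : ℝ} (hs : 0 < s) (hsr : s ≤ r) :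
    ∫⁻ x, ENNReal.ofReal (r ^ 2 + s ^ 2 + 2 * r * s * ⟪u, x⟫) ^ (-p / 2) ∂μ
      ≤ ENNReal.ofReal (r ^ (-p)) := by
  have hstrict : ∀ s, 0 ≤ s → s < r →
      ∫⁻ x, ENNReal.ofReal (r ^ 2 + s ^ 2 + 2 * r * s * ⟪u, x⟫) ^ (-p / 2) ∂μ
        ≤ ENNReal.ofReal (r ^ (-p)) := by
    intro s hs hsr
    have hpos : ∀ t ∈ Icc (-1 : ℝ) 1, 0 < r ^ 2 + s ^ 2 + 2 * r * s * t := by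
      intro t ht
      have h1 : 0 < (r - s) ^ 2 := pow_pos (sub_pos.2 hsr) 2
      nlinarith [mul_nonneg (mul_nonneg (hs.trans hsr.le) hs) (neg_le_iff_add_nonneg.1 ht.1)]
    have hint : Integrable (fun x => (r ^ 2 + s ^ 2 + 2 * r * s * ⟪u, x⟫) ^ (-p / 2)) μ :=
      hμ.integrable_of_continuousOn (ContinuousOn.rpow_const (by fun_prop) fun x hx =>
        Or.inl (hpos _ (real_inner_mem_Icc_of_norm_eq_one hu (by simpa using hx))).ne')
    refine le_trans (le_of_eq ?_)
      (ENNReal.ofReal_le_ofReal (hμ.integral_rpow_le hd hp0 hpd hu hs hsr))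
    rw [ofReal_integral_eq_lintegral_ofReal hint]
    · refine lintegral_congr_ae ?_
      filter_upwards [hμ.ae_norm_eq_one] with x hx
      exact ENNReal.ofReal_rpow_of_pos (hpos _ (real_inner_mem_Icc_of_norm_eq_one hu hx))
    · filter_upwards [hμ.ae_norm_eq_one] with x hx
      exact (rpow_pos_of_pos (hpos _ (real_inner_mem_Icc_of_norm_eq_one hu hx)) _).le
  obtain ⟨σ, -, hσ, hσlim⟩ := exists_seq_strictMono_tendsto' hs
  have hF : ∀ x, Tendsto
      (fun n => ENNReal.ofReal (r ^ 2 + σ n ^ 2 + 2 * r * σ n * ⟪u, x⟫) ^ (-p / 2)) atTop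
      (𝓝 (ENNReal.ofReal (r ^ 2 + s ^ 2 + 2 * r * s * ⟪u, x⟫) ^ (-p / 2))) := fun x =>
    ((ENNReal.continuous_rpow_const.comp (ENNReal.continuous_ofReal.comp
      (by fun_prop : Continuous fun s : ℝ => r ^ 2 + s ^ 2 + 2 * r * s * ⟪u, x⟫))).tendsto s).comp
        hσlim
  calc ∫⁻ x, ENNReal.ofReal (r ^ 2 + s ^ 2 + 2 * r * s * ⟪u, x⟫) ^ (-p / 2) ∂μ
      = ∫⁻ x, liminf (fun n =>
          ENNReal.ofReal (r ^ 2 + σ n ^ 2 + 2 * r * σ n * ⟪u, x⟫) ^ (-p / 2)) atTop ∂μ :=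
        lintegral_congr fun x => (hF x).liminf_eq.symm
    _ ≤ liminf (fun n => ∫⁻ x,
          ENNReal.ofReal (r ^ 2 + σ n ^ 2 + 2 * r * σ n * ⟪u, x⟫) ^ (-p / 2) ∂μ) atTop :=
        lintegral_liminf_le fun n => by fun_prop
    _ ≤ liminf (fun _ : ℕ => ENNReal.ofReal (r ^ (-p))) atTop :=
        liminf_le_liminf (Eventually.of_forall fun n =>
          hstrict _ (hσ n).1.le ((hσ n).2.trans_le hsr))
    _ = ENNReal.ofReal (r ^ (-p)) := liminf_const _

end IsUniformOnSphere

/-- For `d ≥ 3`, `ξ` uniform on `S^{d-1}`, `0 < p ≤ d - 2`, any nonzero `v ∈ ℝ^d`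
and `a > 0`: `E|v + aξ|^{-p} ≤ min{|v|^{-p}, a^{-p}}`. -/
theorem neg_moment_projection_bound
    (d : ℕ) (hd : 3 ≤ d) (p : ℝ) (hp0 : 0 < p) (hpd : p ≤ (d : ℝ) - 2)
    (μ : Measure (EuclideanSpace ℝ (Fin d))) [IsProbabilityMeasure μ]
    (hμ : IsUniformOnSphere μ)
    (v : EuclideanSpace ℝ (Fin d)) (hv : v ≠ 0) (a : ℝ) (ha : 0 < a) :
    ∫⁻ x, (‖v + a • x‖₊ : ℝ≥0∞) ^ (-p) ∂μ
      ≤ ENNReal.ofReal (min (‖v‖ ^ (-p)) (a ^ (-p))) := by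
  have hv0 : 0 < ‖v‖ := norm_pos_iff.2 hv
  have hu : ‖(‖v‖⁻¹ • v)‖ = 1 := by
    rw [norm_smul, norm_inv, norm_norm, inv_mul_cancel₀ hv0.ne']
  have hmin : min (‖v‖ ^ (-p)) (a ^ (-p)) = max ‖v‖ a ^ (-p) := by
    rcases le_total ‖v‖ a with h | h
    · rw [max_eq_right h, min_eq_right (rpow_le_rpow_of_nonpos hv0 h (by linarith))]
    · rw [max_eq_left h, min_eq_left (rpow_le_rpow_of_nonpos ha h (by linarith))]
  rw [hmin]
  refine le_trans (le_of_eq ?_) (hμ.lintegral_ofReal_rpow_le hd hp0 hpd hu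
    (lt_min hv0 ha) (min_le_max (a := ‖v‖) (b := a)))
  refine lintegral_congr_ae ?_
  filter_upwards [hμ.ae_norm_eq_one] with x hx
  have hsq : ‖v + a • x‖ ^ 2 = max ‖v‖ a ^ 2 + min ‖v‖ a ^ 2
      + 2 * max ‖v‖ a * min ‖v‖ a * inner ℝ (‖v‖⁻¹ • v) x := by
    have h1 : max ‖v‖ a ^ 2 + min ‖v‖ a ^ 2 = ‖v‖ ^ 2 + a ^ 2 := by
      rcases le_total ‖v‖ a with h | h <;> simp [h, add_comm]
    rw [h1, mul_assoc 2, max_mul_min, norm_add_sq_real, norm_smul, hx, real_inner_smul_left,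
      real_inner_smul_right, norm_of_nonneg ha.le]
    field_simp
    ring
  rw [← hsq, ENNReal.ofReal_pow (norm_nonneg _), ofReal_norm, ← ENNReal.rpow_natCast,
    ← ENNReal.rpow_mul]
  change ‖v + a • x‖ₑ ^ (-p) = _
  congr 1
  push_cast
  ring
end

section
/- For every real q with 1/8 ≤ q ≤ 1 and every real t with 0 ≤ t ≤ 1, one has 1 - (q(1-q)/2) t - (q²(1-q²)/12) t² ≤ Γ(2-q) · ( 2 - ((3-t)/2)^{-q} ). -/
open Real

section LowerBound

open Filter Topology

/-- The single-factor estimate behind the lower bound for `Γ(2-q)`. -/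
lemma log_one_sub_mul_sub_mul_log_one_sub_le {q v : ℝ} (hq0 : 0 ≤ q) (hq1 : q ≤ 1)
    (hv0 : 0 ≤ v) (hv1 : v ≤ 1 / 2) :
    log (1 - q * v) - q * log (1 - v)
      ≤ (q * (1 - q) / 2 + q ^ 2 * (1 - q ^ 2) / 12) * (v ^ 2 / (1 - v)) := by
  set A : ℝ := q * (1 - q) / 2 + q ^ 2 * (1 - q ^ 2) / 12 with hA
  have hpos : ∀ w ∈ Set.Icc (0 : ℝ) (1 / 2), 0 < 1 - w ∧ 0 < 1 - q * w := by
    intro w hw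
    have := mul_le_mul hq1 hw.2 hw.1 zero_le_one
    exact ⟨by linarith [hw.2], by linarith⟩
  have hderiv : ∀ w ∈ Set.Icc (0 : ℝ) (1 / 2),
      HasDerivAt (fun w : ℝ => A * (w ^ 2 / (1 - w)) - log (1 - q * w) + q * log (1 - w))
        (A * ((2 * w * (1 - w) + w ^ 2) / (1 - w) ^ 2) + q / (1 - q * w) - q / (1 - w)) w := by
    intro w hw
    obtain ⟨h1, h2⟩ := hpos w hw
    have e1 : HasDerivAt (fun w : ℝ => 1 - w) (-1) w := (hasDerivAt_id w).const_sub 1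
    have e2 : HasDerivAt (fun w : ℝ => 1 - q * w) (-(q * 1)) w :=
      ((hasDerivAt_id w).const_mul q).const_sub 1
    have e3 := (((hasDerivAt_pow 2 w).div e1 h1.ne').const_mul A).sub (e2.log h2.ne')
    refine (e3.add ((e1.log h1.ne').const_mul q)).congr_deriv ?_
    push_cast
    ring
  have hmono : MonotoneOn
      (fun w : ℝ => A * (w ^ 2 / (1 - w)) - log (1 - q * w) + q * log (1 - w))
      (Set.Icc 0 (1 / 2)) := by
    refine monotoneOn_of_deriv_nonneg (convex_Icc _ _)
      (fun w hw => (hderiv w hw).continuousAt.continuousWithinAt)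
      (fun w hw => (hderiv w (interior_subset hw)).differentiableAt.differentiableWithinAt) ?_
    intro w hw
    have hw' := interior_subset hw
    rw [(hderiv w hw').deriv]
    obtain ⟨h1, h2⟩ := hpos w hw'
    have hkey : 0 ≤ (1 / 2 + q * (1 + q) / 12) * (2 - w) * (1 - q * w) - (1 - w) := by
      obtain ⟨hw0, hw1⟩ := hw'
      nlinarith [mul_nonneg hq0 (sub_nonneg.2 hq1), mul_nonneg hw0 (sub_nonneg.2 hw1),
        mul_nonneg hq0 (sub_nonneg.2 hw1), mul_nonneg (mul_nonneg hq0 hq0) (sub_nonneg.2 hw1),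
        mul_nonneg hw0 (sub_nonneg.2 hq1),
        mul_nonneg (mul_nonneg hq0 (sub_nonneg.2 hq1)) (sub_nonneg.2 hw1),
        mul_nonneg (mul_nonneg hq0 (sub_nonneg.2 hq1)) hw0]
    have e : A * ((2 * w * (1 - w) + w ^ 2) / (1 - w) ^ 2) + q / (1 - q * w) - q / (1 - w)
        = q * (1 - q) * w * ((1 / 2 + q * (1 + q) / 12) * (2 - w) * (1 - q * w) - (1 - w))
          / ((1 - w) ^ 2 * (1 - q * w)) := by
      rw [hA]
      field_simp
      ring
    rw [e]
    exact div_nonneg (mul_nonneg (mul_nonneg (mul_nonneg hq0 (by linarith)) hw'.1) hkey)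
      (by positivity)
  have h := hmono (Set.left_mem_Icc.2 (by norm_num)) ⟨hv0, hv1⟩ hv0
  simp only [mul_zero, sub_zero, log_one, ne_eq, OfNat.ofNat_ne_zero, not_false_eq_true,
    zero_pow, zero_div, add_zero] at h
  linarith

lemma neg_le_log_Gamma_two_sub {q : ℝ} (hq0 : 0 ≤ q) (hq1 : q < 1) :
    -(q * (1 - q) / 2 + q ^ 2 * (1 - q ^ 2) / 12) ≤ log (Gamma (2 - q)) := by
  set A : ℝ := q * (1 - q) / 2 + q ^ 2 * (1 - q ^ 2) / 12 with hA
  have hA0 : 0 ≤ A := by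
    have : 0 ≤ 1 - q := by linarith
    have : 0 ≤ 1 - q ^ 2 := by nlinarith
    positivity
  have hstep : ∀ n : ℕ, -A * (1 - 1 / ((n : ℝ) + 1)) - (1 - q) * log (n + 1)
      ≤ log (n.factorial : ℝ) - ∑ m ∈ Finset.range (n + 1), log (1 - q + m) + log (1 - q) := by
    intro n
    induction n with
    | zero => simp
    | succ n ih =>
      rw [Finset.sum_range_succ, Nat.factorial_succ]
      have hn : (0 : ℝ) ≤ n := n.cast_nonneg
      have hv := log_one_sub_mul_sub_mul_log_one_sub_le (v := 1 / ((n : ℝ) + 2)) hq0 hq1.le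
        (by positivity) (by rw [div_le_div_iff₀] <;> linarith)
      have e1 : 1 - q * (1 / ((n : ℝ) + 2)) = (n + 2 - q) / (n + 2) := by field_simp
      have e2 : 1 - 1 / ((n : ℝ) + 2) = (n + 1) / (n + 2) := by field_simp; ring
      have e3 : (1 / ((n : ℝ) + 2)) ^ 2 / ((n + 1) / (n + 2))
          = 1 / ((n : ℝ) + 1) - 1 / (n + 1 + 1) := by
        field_simp
        ring
      rw [e1, e2, e3, log_div (by linarith) (by linarith), log_div (by linarith) (by linarith)]
        at hv
      push_cast
      rw [log_mul (by positivity) (by positivity)]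
      rw [show (n : ℝ) + 1 + 1 = n + 2 by ring] at hv ⊢
      rw [show 1 - q + ((n : ℝ) + 1) = n + 2 - q by ring]
      rw [← hA] at hv
      linarith
  have hlim : Tendsto (fun n : ℕ => BohrMollerup.logGammaSeq (1 - q) n + log (1 - q)) atTop
      (𝓝 (log (Gamma (2 - q)))) := by
    have h := (BohrMollerup.tendsto_log_gamma (x := 1 - q) (by linarith)).add_const (log (1 - q))
    rwa [add_comm (log (Gamma _)), ← log_mul (by linarith)
      (Gamma_pos_of_pos (by linarith)).ne', ← Gamma_add_one (by linarith),
      show 1 - q + 1 = 2 - q by ring] at h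
  have hlow : Tendsto (fun n : ℕ => -A - (1 - q) * (1 / (n : ℝ))) atTop (𝓝 (-A)) := by
    simpa using (tendsto_one_div_atTop_nhds_zero_nat.const_mul (1 - q)).const_sub (-A)
  refine le_of_tendsto_of_tendsto hlow hlim ?_
  filter_upwards [eventually_gt_atTop 0] with n hn
  have hn' : (0 : ℝ) < n := Nat.cast_pos.2 hn
  have h1 := hstep n
  have h2 : log ((n : ℝ) + 1) - log n ≤ 1 / n := by
    rw [← log_div (by positivity) (by positivity)]
    refine (log_le_sub_one_of_pos (by positivity)).trans_eq ?_
    field_simp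
    ring
  have h3 : 0 ≤ A * (1 / ((n : ℝ) + 1)) := by positivity
  have h4 := mul_le_mul_of_nonneg_left h2 (sub_nonneg.2 hq1.le)
  unfold BohrMollerup.logGammaSeq
  linarith

/-- The case `t = 1` of the two-point inequality. -/
lemma one_sub_le_Gamma_two_sub {q : ℝ} (hq0 : 0 ≤ q) (hq1 : q ≤ 1) :
    1 - (q * (1 - q) / 2 + q ^ 2 * (1 - q ^ 2) / 12) ≤ Gamma (2 - q) := by
  rcases hq1.eq_or_lt with rfl | hq1
  · norm_num
  · have h := neg_le_log_Gamma_two_sub hq0 hq1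
    rw [le_log_iff_exp_le (Gamma_pos_of_pos (by linarith))] at h
    linarith [add_one_le_exp (-(q * (1 - q) / 2 + q ^ 2 * (1 - q ^ 2) / 12))]

end LowerBound

section ZeroEndpoint

lemma Gamma_add_nat_eq_mul_prod {x : ℝ} (hx : 0 < x) (n : ℕ) :
    Gamma (x + n) = Gamma x * ∏ k ∈ Finset.range n, (x + k) := by
  induction n with
  | zero => simp
  | succ n ih =>
    rw [Finset.prod_range_succ, ← mul_assoc, ← ih, Nat.cast_succ, ← add_assoc,
      Gamma_add_one (by positivity), mul_comm]

lemma le_Gamma_fifteen_div_eight : (100000 / 104941 : ℝ) ≤ Gamma (15 / 8) := by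
  have hnat : 150 * (∏ k ∈ Finset.range 148, (15 + 8 * k)) ^ 8 * 100000 ^ 8
      ≤ (8 ^ 148 * Nat.factorial 149) ^ 8 * 104941 ^ 8 := by
    norm_num [Finset.prod_range_succ, Nat.factorial]
  have hg : 0 < Gamma (15 / 8) := Gamma_pos_of_pos (by norm_num)
  have hprod : Gamma (15 / 8 + (148 : ℕ)) * 8 ^ 148
      = Gamma (15 / 8) * ((∏ k ∈ Finset.range 148, (15 + 8 * k) : ℕ) : ℝ) := by
    rw [Gamma_add_nat_eq_mul_prod (by norm_num), mul_assoc]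
    congr 1
    have h8 : (8 : ℝ) ^ 148 = ∏ _k ∈ Finset.range 148, (8 : ℝ) := by simp
    rw [h8, ← Finset.prod_mul_distrib, Nat.cast_prod]
    refine Finset.prod_congr rfl fun k _ => ?_
    push_cast
    ring
  have hconv : Gamma 150 ^ 8 ≤ 150 * Gamma (15 / 8 + (148 : ℕ)) ^ 8 := by
    set u := Gamma (15 / 8 + (148 : ℕ)) with hu
    have hu0 : 0 < u := Gamma_pos_of_pos (by norm_num)
    have h150 : 0 < Gamma 150 := Gamma_pos_of_pos (by norm_num)
    have h := Gamma_mul_add_mul_le_rpow_Gamma_mul_rpow_Gamma (s := 15 / 8 + (148 : ℕ)) (t := 151)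
      (a := 8 / 9) (b := 1 / 9) (by norm_num) (by norm_num) (by norm_num) (by norm_num)
      (by norm_num)
    rw [← hu, show (8 / 9 * (15 / 8 + ((148 : ℕ) : ℝ)) + 1 / 9 * 151) = 150 by norm_num,
      show (151 : ℝ) = 150 + 1 by norm_num, Gamma_add_one (by norm_num)] at h
    have h9 := pow_le_pow_left₀ h150.le h 9
    rw [mul_pow, ← rpow_natCast, ← rpow_natCast (_ ^ (8 / 9 : ℝ)), ← rpow_natCast (_ ^ (1 / 9 : ℝ)),
      ← rpow_mul hu0.le, ← rpow_mul (by positivity)] at h9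
    norm_num only [Nat.cast_ofNat] at h9
    rw [rpow_one, show (9 : ℝ) = ((9 : ℕ) : ℝ) by norm_num,
      show (8 : ℝ) = ((8 : ℕ) : ℝ) by norm_num, rpow_natCast, rpow_natCast] at h9
    refine le_of_mul_le_mul_right ?_ h150
    calc Gamma 150 ^ 8 * Gamma 150 = Gamma 150 ^ 9 := by ring
      _ ≤ u ^ 8 * (150 * Gamma 150) := h9
      _ = 150 * u ^ 8 * Gamma 150 := by ring
  have hfac : Gamma 150 = (Nat.factorial 149 : ℝ) := by
    rw [← Gamma_nat_eq_factorial]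
    norm_num
  rw [hfac] at hconv
  have hcast : (150 : ℝ) * ((∏ k ∈ Finset.range 148, (15 + 8 * k) : ℕ) : ℝ) ^ 8 * 100000 ^ 8
      ≤ (8 ^ 148 * (Nat.factorial 149 : ℝ)) ^ 8 * 104941 ^ 8 := by
    exact_mod_cast hnat
  generalize Gamma (15 / 8 + (148 : ℕ)) = u at *
  generalize hP : ((∏ k ∈ Finset.range 148, (15 + 8 * k) : ℕ) : ℝ) = P at *
  have hP0 : 0 < P := by
    rw [← hP, Nat.cast_pos]
    exact Finset.prod_pos fun k _ => by omega
  generalize (Nat.factorial 149 : ℝ) = f at *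
  generalize Gamma (15 / 8) = g at *
  generalize (8 : ℝ) ^ 148 = c at *
  have h1 : (c * f) ^ 8 ≤ 150 * (g * P) ^ 8 := by
    rw [← hprod, mul_pow, mul_pow]
    have hc : 0 ≤ c ^ 8 := by positivity
    linarith [mul_le_mul_of_nonneg_left hconv hc]
  have h2 : (100000 : ℝ) ^ 8 * (150 * P ^ 8) ≤ (g * 104941) ^ 8 * (150 * P ^ 8) := by
    have := mul_le_mul_of_nonneg_right h1 (show (0 : ℝ) ≤ 104941 ^ 8 by positivity)
    rw [mul_pow g P] at this
    rw [mul_pow g]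
    linarith
  have h3 := le_of_mul_le_mul_right h2 (by positivity)
  rw [div_le_iff₀ (by norm_num)]
  exact le_of_pow_le_pow_left₀ (by norm_num) (by positivity) h3

lemma one_le_Gamma_fifteen_div_eight_mul :
    1 ≤ Gamma (15 / 8) * (2 - (3 / 2 : ℝ) ^ (-(1 / 8) : ℝ)) := by
  have h : (3 / 2 : ℝ) ^ (-(1 / 8) : ℝ) ≤ 95059 / 100000 := by
    refine le_of_pow_le_pow_left₀ (n := 8) (by norm_num) (by norm_num) ?_
    rw [← rpow_natCast, ← rpow_mul (by norm_num)]
    norm_num [rpow_neg_one]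
  calc (1 : ℝ) = 100000 / 104941 * (2 - 95059 / 100000) := by norm_num
    _ ≤ _ := mul_le_mul le_Gamma_fifteen_div_eight (by linarith) (by norm_num)
      (Gamma_pos_of_pos (by norm_num)).le

lemma convexOn_log_two_sub_exp_sub_log :
    ConvexOn ℝ (Set.Icc 0 1) fun q : ℝ =>
      log (2 - exp (-(log (3 / 2) * q))) - log (2 - q) - log (3 - q) := by
  set a := log (3 / 2) with ha
  have ha0 : 0 < a := log_pos (by norm_num)
  have ha1 : a ≤ 0.42 := by
    rw [ha, log_le_iff_le_exp (by norm_num)]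
    have := quadratic_le_exp_of_nonneg (x := 0.42) (by norm_num)
    norm_num at this ⊢
    linarith
  have hE : ∀ q : ℝ, 0 ≤ q → 0 < exp (-(a * q)) ∧ exp (-(a * q)) ≤ 1 := fun q hq =>
    ⟨exp_pos _, exp_le_one_iff.2 (by nlinarith)⟩
  have hdE : ∀ q : ℝ, HasDerivAt (fun q : ℝ => exp (-(a * q))) (-(a * exp (-(a * q)))) q := by
    intro q
    have h : HasDerivAt (fun q : ℝ => -(a * q)) (-(a * 1)) q :=
      ((hasDerivAt_id q).const_mul a).neg
    exact h.exp.congr_deriv (by ring)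
  have hd1 : ∀ q ∈ Set.Icc (0 : ℝ) 1, HasDerivAt
      (fun q : ℝ => log (2 - exp (-(a * q))) - log (2 - q) - log (3 - q))
      (a * exp (-(a * q)) / (2 - exp (-(a * q))) + 1 / (2 - q) + 1 / (3 - q)) q := by
    intro q hq
    have h2 : (2 : ℝ) - q ≠ 0 := by linarith [hq.2]
    have h3 : (3 : ℝ) - q ≠ 0 := by linarith [hq.2]
    have hw : 2 - exp (-(a * q)) ≠ 0 := by linarith [(hE q hq.1).2]
    refine (((((hdE q).const_sub 2).log hw).sub (((hasDerivAt_id q).const_sub 2).log h2)).sub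
      (((hasDerivAt_id q).const_sub 3).log h3)).congr_deriv ?_
    simp only [id]
    ring
  refine convexOn_of_hasDerivWithinAt2_nonneg (convex_Icc 0 1)
    (f' := fun q => a * exp (-(a * q)) / (2 - exp (-(a * q))) + 1 / (2 - q) + 1 / (3 - q))
    (f'' := fun q => -(2 * a ^ 2 * exp (-(a * q))) / (2 - exp (-(a * q))) ^ 2
      + 1 / (2 - q) ^ 2 + 1 / (3 - q) ^ 2)
    (fun q hq => (hd1 q hq).continuousAt.continuousWithinAt)
    (fun q hq => (hd1 q (interior_subset hq)).hasDerivWithinAt) ?_ ?_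
  · intro q hq
    replace hq := interior_subset hq
    have h2 : (2 : ℝ) - q ≠ 0 := by linarith [hq.2]
    have h3 : (3 : ℝ) - q ≠ 0 := by linarith [hq.2]
    have hw : 2 - exp (-(a * q)) ≠ 0 := by linarith [(hE q hq.1).2]
    refine HasDerivAt.hasDerivWithinAt ?_
    refine (((((hdE q).const_mul a).div ((hdE q).const_sub 2) hw).add
      ((hasDerivAt_const q (1 : ℝ)).div ((hasDerivAt_id q).const_sub 2) h2)).add
      ((hasDerivAt_const q (1 : ℝ)).div ((hasDerivAt_id q).const_sub 3) h3)).congr_deriv ?_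
    simp only [id]
    ring
  · intro q hq
    replace hq := interior_subset hq
    obtain ⟨hw0, hw1⟩ := hE q hq.1
    set w := exp (-(a * q))
    have h2 : 1 / 4 ≤ 1 / (2 - q) ^ 2 :=
      one_div_le_one_div_of_le (by nlinarith [hq.2]) (by nlinarith [hq.1, hq.2])
    have h3 : 1 / 9 ≤ 1 / (3 - q) ^ 2 :=
      one_div_le_one_div_of_le (by nlinarith [hq.2]) (by nlinarith [hq.1, hq.2])
    have h4 : -(13 / 36) ≤ -(2 * a ^ 2 * w) / (2 - w) ^ 2 := by
      rw [le_div_iff₀ (by nlinarith)]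
      have : w ≤ (2 - w) ^ 2 := by nlinarith
      have : 2 * a ^ 2 ≤ 13 / 36 := by nlinarith
      nlinarith
    linarith

/-- The case `t = 0` of the two-point inequality. -/
lemma one_le_Gamma_two_sub_mul {q : ℝ} (hq1 : 1 / 8 ≤ q) (hq2 : q ≤ 1) :
    1 ≤ Gamma (2 - q) * (2 - (3 / 2 : ℝ) ^ (-q)) := by
  have hx : ∀ r : ℝ, (3 / 2 : ℝ) ^ (-r) = exp (-(log (3 / 2) * r)) := fun r => by
    rw [rpow_def_of_pos (by norm_num), mul_neg]
  have hw : ∀ r : ℝ, 0 ≤ r → 0 < 2 - (3 / 2 : ℝ) ^ (-r) := fun r hr => by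
    have := rpow_le_one_of_one_le_of_nonpos (x := (3 / 2 : ℝ)) (by norm_num) (neg_nonpos.2 hr)
    linarith
  have hG : ∀ r : ℝ, r ≤ 1 → 0 < Gamma (2 - r) := fun r hr => Gamma_pos_of_pos (by linarith)
  set f : ℝ → ℝ := fun r => log (Gamma (2 - r) * (2 - (3 / 2 : ℝ) ^ (-r))) with hf
  have hconv : ConvexOn ℝ (Set.Icc 0 1) f := by
    have hΓ : ConvexOn ℝ (Set.Icc (0 : ℝ) 1) fun r => log (Gamma (4 - r)) := by
      refine ⟨convex_Icc 0 1, fun x hx y hy b c hb hc hbc => ?_⟩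
      have h := convexOn_log_Gamma.2 (x := 4 - x) (y := 4 - y)
        (Set.mem_Ioi.2 (by linarith [hx.2])) (Set.mem_Ioi.2 (by linarith [hy.2])) hb hc hbc
      simp only [smul_eq_mul, Function.comp_apply] at h ⊢
      rwa [show b * (4 - x) + c * (4 - y) = 4 - (b * x + c * y) by
        linear_combination 4 * hbc] at h
    refine (hΓ.add convexOn_log_two_sub_exp_sub_log).congr fun r hr => ?_
    simp only [hf, Pi.add_apply]
    have e : Gamma (4 - r) = (3 - r) * ((2 - r) * Gamma (2 - r)) := by
      rw [← Gamma_add_one (by linarith [hr.2]), show 2 - r + 1 = 3 - r by ring,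
        ← Gamma_add_one (by linarith [hr.2])]
      ring_nf
    have h2 : (2 : ℝ) - r ≠ 0 := by linarith [hr.2]
    have h3 : (3 : ℝ) - r ≠ 0 := by linarith [hr.2]
    rw [e, log_mul h3 (mul_ne_zero h2 (hG r hr.2).ne'), log_mul h2 (hG r hr.2).ne',
      log_mul (hG r hr.2).ne' (hw r hr.1).ne', hx]
    ring
  have hf0 : f 0 = 0 := by
    norm_num [hf]
  have hf8 : 0 ≤ f (1 / 8) := by
    refine log_nonneg ?_
    convert one_le_Gamma_fifteen_div_eight_mul using 3
    norm_num
  have hfq : 0 ≤ f q := by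
    have hq0 : 0 < q := by linarith
    have h := hconv.2 (Set.left_mem_Icc.2 zero_le_one) ⟨hq0.le, hq2⟩
      (sub_nonneg.2 ((div_le_one hq0).2 hq1)) (show 0 ≤ 1 / 8 / q by positivity) (by ring)
    rw [hf0, smul_zero, zero_add, zero_add, smul_eq_mul, smul_eq_mul,
      div_mul_cancel₀ _ hq0.ne'] at h
    exact nonneg_of_mul_nonneg_right (hf8.trans h) (by positivity)
  exact (log_nonneg_iff (mul_pos (hG q hq2) (hw q (by linarith)))).1 hfq

end ZeroEndpoint

lemma concaveOn_two_point_difference {q : ℝ} (hq0 : 0 ≤ q) (hq1 : q ≤ 1) :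
    ConcaveOn ℝ (Set.Icc 0 1) fun t : ℝ =>
      Gamma (2 - q) * (2 - ((3 - t) / 2) ^ (-q))
        - (1 - (q * (1 - q) / 2) * t - (q ^ 2 * (1 - q ^ 2) / 12) * t ^ 2) := by
  set G := Gamma (2 - q) with hG
  have hG0 : 27 / 32 ≤ G := by
    have := one_sub_le_Gamma_two_sub hq0 hq1
    nlinarith [sq_nonneg (q - 1 / 2), sq_nonneg (q ^ 2 - 1 / 2)]
  have hx : ∀ t : ℝ, HasDerivAt (fun t : ℝ => (3 - t) / 2) (-1 / 2) t := fun t =>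
    ((hasDerivAt_id t).const_sub 3).div_const 2
  have hd1 : ∀ t ∈ Set.Icc (0 : ℝ) 1, HasDerivAt
      (fun t : ℝ => G * (2 - ((3 - t) / 2) ^ (-q))
        - (1 - (q * (1 - q) / 2) * t - (q ^ 2 * (1 - q ^ 2) / 12) * t ^ 2))
      (-(G * q / 2) * ((3 - t) / 2) ^ (-q - 1) + q * (1 - q) / 2
        + q ^ 2 * (1 - q ^ 2) / 6 * t) t := by
    intro t ht
    have h := (((hx t).rpow_const (p := -q) (Or.inl (by linarith [ht.2]))).const_sub 2).const_mul G
    refine (h.sub ((((hasDerivAt_id t).const_mul (q * (1 - q) / 2)).const_sub 1).sub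
      ((hasDerivAt_pow 2 t).const_mul (q ^ 2 * (1 - q ^ 2) / 12)))).congr_deriv ?_
    push_cast
    ring
  refine concaveOn_of_hasDerivWithinAt2_nonpos (convex_Icc 0 1)
    (f' := fun t => -(G * q / 2) * ((3 - t) / 2) ^ (-q - 1) + q * (1 - q) / 2
        + q ^ 2 * (1 - q ^ 2) / 6 * t)
    (f'' := fun t => -(G * q * (q + 1) / 4) * ((3 - t) / 2) ^ (-q - 1 - 1)
        + q ^ 2 * (1 - q ^ 2) / 6)
    (fun t ht => (hd1 t ht).continuousAt.continuousWithinAt)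
    (fun t ht => (hd1 t (interior_subset ht)).hasDerivWithinAt) ?_ ?_
  · intro t ht
    replace ht := interior_subset ht
    refine HasDerivAt.hasDerivWithinAt ?_
    have h := ((hx t).rpow_const (p := -q - 1) (Or.inl (by linarith [ht.2]))).const_mul (-(G * q / 2))
    refine ((h.add_const (q * (1 - q) / 2)).add
      ((hasDerivAt_id t).const_mul (q ^ 2 * (1 - q ^ 2) / 6))).congr_deriv ?_
    ring
  · intro t ht
    replace ht := interior_subset ht
    have hpow : 8 / 27 ≤ ((3 - t) / 2) ^ (-q - 1 - 1) := by
      have h1 : (1 : ℝ) ≤ (3 - t) / 2 := by linarith [ht.2]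
      calc (8 / 27 : ℝ) = ((3 / 2 : ℝ) ^ 3)⁻¹ := by norm_num
        _ ≤ (((3 - t) / 2) ^ 3)⁻¹ := by
          refine inv_anti₀ (by positivity) (pow_le_pow_left₀ (by linarith) (by linarith [ht.1]) 3)
        _ = ((3 - t) / 2) ^ (-(3 : ℕ) : ℝ) := by
          rw [rpow_neg (by linarith), rpow_natCast]
        _ ≤ ((3 - t) / 2) ^ (-q - 1 - 1) :=
          rpow_le_rpow_of_exponent_le h1 (by push_cast; linarith)
    have hGp : 1 / 4 ≤ G * ((3 - t) / 2) ^ (-q - 1 - 1) := by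
      have := mul_le_mul hG0 hpow (by norm_num) (by linarith)
      linarith
    have hqq : 0 ≤ q * (q + 1) := by positivity
    have h1 := mul_le_mul_of_nonneg_left hGp hqq
    have h2 : q * (q + 1) * (q * (1 - q)) ≤ q * (q + 1) * (1 / 4) :=
      mul_le_mul_of_nonneg_left (by nlinarith [sq_nonneg (q - 1 / 2)]) hqq
    linarith

/-- For `1/8 ≤ q ≤ 1` and `0 ≤ t ≤ 1`,
`1 - (q(1-q)/2) t - (q²(1-q²)/12) t² ≤ Γ(2-q) (2 - ((3-t)/2)^{-q})`. -/
theorem ind_base_two_point_inequality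
    (q t : ℝ) (hq1 : 1 / 8 ≤ q) (hq2 : q ≤ 1) (ht0 : 0 ≤ t) (ht1 : t ≤ 1) :
    1 - (q * (1 - q) / 2) * t - (q ^ 2 * (1 - q ^ 2) / 12) * t ^ 2
      ≤ Real.Gamma (2 - q) * (2 - ((3 - t) / 2) ^ (-q)) := by
  have hq0 : 0 ≤ q := by linarith
  have h := (concaveOn_two_point_difference hq0 hq2).2 (Set.left_mem_Icc.2 zero_le_one)
    (Set.right_mem_Icc.2 zero_le_one) (sub_nonneg.2 ht1) ht0 (by ring)
  have h0 := one_le_Gamma_two_sub_mul hq1 hq2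
  have h1 := one_sub_le_Gamma_two_sub hq0 hq2
  norm_num only [smul_eq_mul, mul_zero, mul_one, zero_add, sub_zero, one_rpow, zero_pow, one_pow,
    ne_eq] at h
  have h2 := mul_nonneg (sub_nonneg.2 ht1) (sub_nonneg.2 h0)
  have h3 := mul_nonneg ht0 (sub_nonneg.2 h1)
  linarith
end
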